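/- Let n ≥ 2 and let T = (a_1, …, a_k) be a tuple of integers with 0 ≤ a_1 < a_2 < ⋯ < a_k < n, and assume either a_1 ≥ 2, or k ≥ 3 with a_1 = 1, a_2 = 3 and a_3 ≥ 5. Then the set of triples { (m, x, y) ∈ ℕ × ℤ × ℤ : m ≥ 3, y ≠ 0 and y^m = g_T(x) } is finite. -/

import Mathlib

open Polynomial Finset

/-- For a non-negative integer `a`, the polynomial `p_a(x) = ∏_{i=0}^{a} (x + i)` over `ℤ`. -/
noncomputable def pP (a : ℕ) : Polynomial ℤ :=
  ∏ i ∈ Finset.range (a + 1), (X + C (i : ℤ))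


lemma ze_ratio (p : ℝ[X]) (hp : p ≠ 0) (c : ℝ) :
    Filter.Tendsto (fun x : ℝ => (p.comp (X + C c)).eval x / p.eval x) Filter.atTop (nhds 1) := by
  have h := Polynomial.div_tendsto_atTop_leadingCoeff_div_of_degree_eq (p.comp (X + C c)) p ?_
  · have h2 : (p.comp (X + C c)).leadingCoeff = p.leadingCoeff := by
      have := Polynomial.leadingCoeff_comp (p := p) (q := X + C c) (by rw [natDegree_X_add_C]; simp)
      rw [this, leadingCoeff_X_add_C]; simp
    rw [h2, div_self (leadingCoeff_ne_zero.mpr hp)] at h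
    exact h
  · have h3 : p.comp (X + C c) ≠ 0 := by
      intro h0
      have := Polynomial.leadingCoeff_comp (p := p) (q := X + C c) (by rw [natDegree_X_add_C]; simp)
      rw [h0, leadingCoeff_X_add_C] at this
      simp at this
      exact hp (leadingCoeff_eq_zero.mp this.symm)
    rw [degree_eq_natDegree h3, degree_eq_natDegree hp, natDegree_comp, natDegree_X_add_C]; simp

lemma zero_est (K L m T S : ℕ) (r y : ℝ) (hr : 0 < r) (hy : 0 < y) (hy1 : y ≠ 1)
    (P : ℕ → ℝ[X]) (hdeg : ∀ l < L, (P l).natDegree < K) (hS : S ≤ m)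
    (hcount : K * L ≤ T * S)
    (hvan : ∀ t < T, ∀ t' < S + L, ∑ l ∈ range L,
      (P l).eval ((t * m + t' : ℕ) : ℝ) * (r ^ t * y ^ t') ^ l = 0) :
    ∀ l < L, P l = 0 := by
  classical
  by_contra hcon
  push Not at hcon
  obtain ⟨l0, hl0, hPl0⟩ := hcon
  set Λ := (range L).filter (fun l => P l ≠ 0) with hΛ
  have hl0m : l0 ∈ Λ := by simp [hΛ, hl0, hPl0]
  set M := Λ.card with hM
  have hMpos : 0 < M := Finset.card_pos.mpr ⟨l0, hl0m⟩
  have hML : M ≤ L := by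
    have := Finset.card_filter_le (range L) (fun l => P l ≠ 0)
    simpa using this
  let e := Λ.orderEmbOfFin (k := M) rfl
  have he : ∀ j, e j ∈ Λ := fun j => Finset.orderEmbOfFin_mem _ _ _
  have heL : ∀ j, e j < L := fun j => by have := he j; simp [hΛ] at this; exact this.1
  have heP : ∀ j, P (e j) ≠ 0 := fun j => by have := he j; simp [hΛ] at this; exact this.2
  have hKpos : 0 < K := lt_of_le_of_lt (Nat.zero_le _) (hdeg l0 hl0)
  let A : Matrix (Fin M) (Fin M) ℝ[X] := Matrix.of fun i j =>
    (P (e j)).comp (X + C ((i : ℕ) : ℝ)) * C (y ^ ((i : ℕ) * e j))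
  have hAev : ∀ (x : ℝ), (A.det).eval x = Matrix.det (Matrix.of fun i j : Fin M =>
      (P (e j)).eval (x + (i : ℕ)) * y ^ ((i : ℕ) * e j)) := by
    intro x
    have := RingHom.map_det (Polynomial.evalRingHom x) A
    simp only [coe_evalRingHom] at this
    rw [this]
    congr 1
    ext i j
    simp [A]
  have hdegA : A.det.natDegree ≤ M * (K - 1) := by
    rw [Matrix.det_apply]
    refine natDegree_sum_le_of_forall_le _ _ (fun σ _ => ?_)
    refine (natDegree_smul_le _ _).trans ?_
    refine (natDegree_prod_le _ _).trans ?_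
    have : ∀ i ∈ (univ : Finset (Fin M)), (A (σ i) i).natDegree ≤ K - 1 := by
      intro i _
      simp only [A, Matrix.of_apply]
      refine (natDegree_mul_C_le _ _).trans ?_
      rw [natDegree_comp, natDegree_X_add_C, mul_one]
      have := hdeg _ (heL i)
      omega
    refine (Finset.sum_le_sum this).trans ?_
    simp
  have hroot : ∀ t < T, ∀ t' < S, (A.det).eval ((t * m + t' : ℕ) : ℝ) = 0 := by
    intro t ht t' ht'
    rw [hAev]
    apply Matrix.exists_mulVec_eq_zero_iff.mp
    refine ⟨fun j => (r ^ t * y ^ t') ^ (e j), ?_, ?_⟩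
    · intro h0
      have := congrFun h0 ⟨0, hMpos⟩
      simp only [Pi.zero_apply] at this
      have h2 : (0 : ℝ) < (r ^ t * y ^ t') ^ (e ⟨0, hMpos⟩) := by positivity
      linarith
    · ext i
      simp only [Matrix.mulVec, dotProduct, Pi.zero_apply, Matrix.of_apply]
      have hv := hvan t ht (t' + i) (by have := i.2; omega)
      have h1 : ∑ l ∈ range L, (P l).eval ((t * m + (t' + i) : ℕ) : ℝ) * (r ^ t * y ^ (t' + i)) ^ l
          = ∑ l ∈ Λ, (P l).eval ((t * m + (t' + i) : ℕ) : ℝ) * (r ^ t * y ^ (t' + i)) ^ l := by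
        rw [hΛ, Finset.sum_filter]
        apply Finset.sum_congr rfl
        intro l _
        split_ifs with h
        · rfl
        · push Not at h
          simp [h]
      rw [h1] at hv
      rw [← hv]
      have h2 : Λ = univ.map e.toEmbedding := by
        ext x
        simp only [Finset.mem_map, Finset.mem_univ, true_and]
        constructor
        · intro hx
          have : x ∈ Set.range (Λ.orderEmbOfFin (k := M) rfl) := by
            rw [Finset.range_orderEmbOfFin]; exact hx
          obtain ⟨j, hj⟩ := this
          exact ⟨j, hj⟩
        · rintro ⟨j, rfl⟩
          exact he j
      conv_rhs => rw [h2]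
      rw [Finset.sum_map]
      apply Finset.sum_congr rfl
      intro j _
      simp only [RelEmbedding.coe_toEmbedding]
      have : (((t * m + (t' + i) : ℕ)) : ℝ) = ((t * m + t' : ℕ) : ℝ) + (i : ℕ) := by push_cast; ring
      rw [this, mul_assoc]
      congr 1
      ring
  have hdet0 : A.det = 0 := by
    by_contra hne
    let R : Finset ℝ := ((range T) ×ˢ (range S)).image (fun q => ((q.1 * m + q.2 : ℕ) : ℝ))
    have hRcard : R.card = T * S := by
      rw [Finset.card_image_of_injOn]
      · simp
      · rintro ⟨t1, s1⟩ h1 ⟨t2, s2⟩ h2 h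
        simp only [coe_product, Set.mem_prod, Finset.mem_coe, Finset.mem_range] at h1 h2
        have h' : t1 * m + s1 = t2 * m + s2 := by
          simp only at h
          exact_mod_cast h
        have hs1 : s1 < m := lt_of_lt_of_le h1.2 hS
        have hs2 : s2 < m := lt_of_lt_of_le h2.2 hS
        have hm1 : (t1 * m + s1) % m = s1 := by
          rw [Nat.add_comm, Nat.add_mul_mod_self_right, Nat.mod_eq_of_lt hs1]
        have hm2 : (t2 * m + s2) % m = s2 := by
          rw [Nat.add_comm, Nat.add_mul_mod_self_right, Nat.mod_eq_of_lt hs2]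
        have hss : s1 = s2 := by rw [← hm1, ← hm2, h']
        subst hss
        have : t1 * m = t2 * m := by omega
        have := Nat.eq_of_mul_eq_mul_right (by omega) this
        simp [this]
    have hsub : R ⊆ A.det.roots.toFinset := by
      intro x hx
      simp only [R, Finset.mem_image, Finset.mem_product, Finset.mem_range] at hx
      obtain ⟨⟨t, s⟩, ⟨ht, hs⟩, rfl⟩ := hx
      rw [Multiset.mem_toFinset, mem_roots hne]
      exact hroot t ht s hs
    have h1 := Finset.card_le_card hsub
    have h2 := (Multiset.toFinset_card_le A.det.roots).trans (card_roots' _)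
    have h3 : T * S ≤ M * (K - 1) := by omega
    have h4 : M * (K - 1) < K * L := by
      calc M * (K - 1) < M * K := Nat.mul_lt_mul_of_pos_left (by omega) hMpos
        _ ≤ K * L := by rw [mul_comm]; exact Nat.mul_le_mul_left _ hML
    omega
  -- limit
  have hlim : Filter.Tendsto (fun x : ℝ => Matrix.det (Matrix.of fun i j : Fin M =>
      ((P (e j)).comp (X + C ((i : ℕ) : ℝ))).eval x / (P (e j)).eval x * y ^ ((i : ℕ) * e j)))
      Filter.atTop (nhds (Matrix.det (Matrix.of fun i j : Fin M => (1 : ℝ) * y ^ ((i : ℕ) * e j)))) := by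
    simp only [Matrix.det_apply, Matrix.of_apply]
    refine tendsto_finsetSum _ (fun σ _ => ?_)
    refine Filter.Tendsto.const_smul ?_ _
    refine tendsto_finsetProd _ (fun i _ => ?_)
    exact (ze_ratio _ (heP i) _).mul_const _
  have hzero : ∀ x : ℝ, Matrix.det (Matrix.of fun i j : Fin M =>
      ((P (e j)).comp (X + C ((i : ℕ) : ℝ))).eval x / (P (e j)).eval x * y ^ ((i : ℕ) * e j)) = 0 := by
    intro x
    have h1 := hAev x
    rw [hdet0, eval_zero] at h1
    have h2 := Matrix.det_mul_row (fun j => ((P (e j)).eval x)⁻¹) (Matrix.of fun i j : Fin M =>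
      (P (e j)).eval (x + (i : ℕ)) * y ^ ((i : ℕ) * e j))
    rw [← h1, mul_zero] at h2
    rw [← h2]
    congr 1
    ext i j
    simp [div_eq_mul_inv]
    ring
  simp only [hzero] at hlim
  have hv0 := tendsto_nhds_unique hlim tendsto_const_nhds
  have hvm : (Matrix.of fun i j : Fin M => (1 : ℝ) * y ^ ((i : ℕ) * e j)) =
      (Matrix.vandermonde (fun j : Fin M => y ^ (e j))).transpose := by
    ext i j
    simp [Matrix.vandermonde_apply, ← pow_mul, mul_comm]
  rw [hvm, Matrix.det_transpose] at hv0
  refine Matrix.det_vandermonde_ne_zero_iff.mpr ?_ hv0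
  intro i j hij
  have := (pow_right_injective₀ hy hy1) hij
  exact e.injective this

lemma schwarz_zeros (A : Finset ℂ) (Q R : ℝ) (hQR : Q < R) (hQ : 0 ≤ Q) :
    ∀ (F : ℂ → ℂ) (M : ℝ), Differentiable ℂ F → (∀ a ∈ A, ‖a‖ ≤ Q ∧ F a = 0) →
    (∀ z, ‖z‖ = R → ‖F z‖ ≤ M) → ∀ z, ‖z‖ ≤ Q → ‖F z‖ ≤ M * (2 * Q / (R - Q)) ^ A.card := by
  classical
  induction A using Finset.induction_on with
  | empty =>
    intro F M hF _ hM z hz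
    simp only [card_empty, pow_zero, mul_one]
    have hR : R ≠ 0 := by linarith
    refine Complex.norm_le_of_forall_mem_frontier_norm_le (U := Metric.ball 0 R) Metric.isBounded_ball
      (hF.diffContOnCl) ?_ ?_
    · intro w hw
      rw [frontier_ball _ hR] at hw
      exact hM w (by simpa using hw)
    · apply subset_closure
      simp; linarith
  | insert a A ha ih =>
    intro F M hF hA hM z hz
    have hRQ : 0 < R - Q := by linarith
    obtain ⟨haQ, hFa⟩ := hA a (mem_insert_self _ _)
    have hG : Differentiable ℂ (dslope F a) := by
      rw [← differentiableOn_univ] at hF ⊢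
      exact (Complex.differentiableOn_dslope Filter.univ_mem).mpr hF
    have hval : ∀ w, F w = (w - a) * dslope F a w := by
      intro w
      have := sub_smul_dslope F a w
      rw [hFa, sub_zero] at this
      rw [← this]; rfl
    have h1 := ih (dslope F a) (M / (R - Q)) hG ?_ ?_ z hz
    · rw [hval z, norm_mul, card_insert_of_notMem ha, pow_succ]
      have h2 : ‖z - a‖ ≤ 2 * Q := by
        calc ‖z - a‖ ≤ ‖z‖ + ‖a‖ := norm_sub_le _ _
          _ ≤ 2 * Q := by linarith
      calc ‖z - a‖ * ‖dslope F a z‖ ≤ (2 * Q) * (M / (R - Q) * (2 * Q / (R - Q)) ^ A.card) := by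
            gcongr
        _ = _ := by field_simp
    · intro b hb
      obtain ⟨hbQ, hFb⟩ := hA b (mem_insert_of_mem hb)
      refine ⟨hbQ, ?_⟩
      have hba : b ≠ a := fun h => ha (h ▸ hb)
      have := hval b
      rw [hFb] at this
      rcases mul_eq_zero.mp this.symm with h | h
      · exact absurd (sub_eq_zero.mp h) hba
      · exact h
    · intro w hw
      have h3 := hM w hw
      rw [hval w, norm_mul] at h3
      have h4 : R - Q ≤ ‖w - a‖ := by
        have := norm_sub_norm_le w a
        linarith
      rw [le_div_iff₀ hRQ]
      calc ‖dslope F a w‖ * (R - Q) ≤ ‖dslope F a w‖ * ‖w - a‖ := by gcongr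
        _ ≤ M := by linarith [mul_comm ‖dslope F a w‖ ‖w - a‖]

lemma fact_le_prod (B : Finset ℕ) (hB : ∀ b ∈ B, 0 < b) : B.card.factorial ≤ ∏ b ∈ B, b := by
  induction B using Finset.induction_on_max with
  | empty => simp
  | insert a s hs ih =>
    have ha : a ∉ s := fun h => lt_irrefl _ (hs a h)
    rw [card_insert_of_notMem ha, prod_insert ha, Nat.factorial_succ]
    apply Nat.mul_le_mul
    · have : insert a s ⊆ Finset.Icc 1 a := by
        intro x hx
        have := hB x hx
        rcases mem_insert.mp hx with rfl | h
        · simp; omega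
        · have := hs x h
          simp; omega
      have := card_le_card this
      rw [card_insert_of_notMem ha] at this
      simpa using this
    · exact ih (fun b hb => hB b (mem_insert_of_mem hb))

lemma fact_le_prod_abs (A : Finset ℕ) (i : ℕ) (hi : i ∈ A) :
    (((A.card - 1).factorial : ℕ) : ℝ) ≤ 2 ^ (A.card - 1) * ∏ j ∈ A.erase i, |(i : ℝ) - j| := by
  classical
  set B1 := (A.erase i).filter (fun j => j < i) with hB1
  set B2 := (A.erase i).filter (fun j => ¬ j < i) with hB2
  have hcard : B1.card + B2.card = A.card - 1 := by
    rw [← card_erase_of_mem hi, hB1, hB2, card_filter_add_card_filter_not]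
  have hp : ∏ j ∈ A.erase i, |(i : ℝ) - j| = (∏ j ∈ B1, |(i : ℝ) - j|) * ∏ j ∈ B2, |(i : ℝ) - j| := by
    rw [hB1, hB2, prod_filter_mul_prod_filter_not]
  have h1 : (B1.card.factorial : ℝ) ≤ ∏ j ∈ B1, |(i : ℝ) - j| := by
    have := fact_le_prod (B1.image (fun j => i - j)) (by
      intro b hb
      simp only [hB1, mem_image, mem_filter] at hb
      obtain ⟨j, ⟨_, hj⟩, rfl⟩ := hb
      omega)
    have hinj : Set.InjOn (fun j => i - j) (B1 : Set ℕ) := by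
      intro x hx y hy h
      simp only [hB1, coe_filter, Set.mem_ofPred_eq] at hx hy
      simp only at h
      omega
    rw [card_image_of_injOn hinj, prod_image hinj] at this
    calc (B1.card.factorial : ℝ) ≤ ((∏ j ∈ B1, (i - j) : ℕ) : ℝ) := by exact_mod_cast this
      _ = _ := by
        rw [Nat.cast_prod]
        apply prod_congr rfl
        intro j hj
        simp only [hB1, mem_filter] at hj
        rw [Nat.cast_sub hj.2.le, abs_of_nonneg]
        have : (j : ℝ) < i := by exact_mod_cast hj.2
        linarith
  have h2 : (B2.card.factorial : ℝ) ≤ ∏ j ∈ B2, |(i : ℝ) - j| := by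
    have hlt : ∀ j ∈ B2, i < j := by
      intro j hj
      simp only [hB2, mem_filter, mem_erase] at hj
      omega
    have := fact_le_prod (B2.image (fun j => j - i)) (by
      intro b hb
      simp only [mem_image] at hb
      obtain ⟨j, hj, rfl⟩ := hb
      have := hlt j hj
      omega)
    have hinj : Set.InjOn (fun j => j - i) (B2 : Set ℕ) := by
      intro x hx y hy h
      have := hlt x hx
      have := hlt y hy
      simp only at h
      omega
    rw [card_image_of_injOn hinj, prod_image hinj] at this
    calc (B2.card.factorial : ℝ) ≤ ((∏ j ∈ B2, (j - i) : ℕ) : ℝ) := by exact_mod_cast this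
      _ = _ := by
        rw [Nat.cast_prod]
        apply prod_congr rfl
        intro j hj
        have hj := hlt j hj
        rw [Nat.cast_sub hj.le, abs_sub_comm, abs_of_nonneg]
        have : (i : ℝ) < j := by exact_mod_cast hj
        linarith
  rw [hp, ← hcard]
  have h3 : ((B1.card + B2.card).factorial : ℝ) ≤ 2 ^ (B1.card + B2.card) * (B1.card.factorial * B2.card.factorial) := by
    have h4 := Nat.add_choose_mul_factorial_mul_factorial B1.card B2.card
    have h5 := Nat.choose_le_two_pow (B1.card + B2.card) B2.card
    have : (B1.card + B2.card).factorial ≤ 2 ^ (B1.card + B2.card) * (B1.card.factorial * B2.card.factorial) := by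
      rw [← h4, mul_assoc]
      exact Nat.mul_le_mul_right _ h5
    exact_mod_cast this
  refine h3.trans ?_
  gcongr

lemma interp_bound (A : Finset ℕ) (hA : A.Nonempty) (R η : ℝ) (hη : 0 ≤ η) (r : ℕ → ℂ)
    (hr : ∀ i ∈ A, ‖r i‖ ≤ η) (hR : ∀ i ∈ A, (i : ℝ) ≤ R) (z : ℂ) (hz : ‖z‖ ≤ R) :
    ‖(Lagrange.interpolate A (fun i : ℕ => (i : ℂ)) r).eval z‖ ≤
      η * (A.card * ((4 * R) ^ (A.card - 1) / (A.card - 1).factorial)) := by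
  classical
  rw [Lagrange.interpolate_apply, eval_finsetSum]
  have hR0 : 0 ≤ R := (norm_nonneg _).trans hz
  have hterm : ∀ i ∈ A, ‖(C (r i) * Lagrange.basis A (fun i : ℕ => (i : ℂ)) i).eval z‖ ≤
      η * ((4 * R) ^ (A.card - 1) / (A.card - 1).factorial) := by
    intro i hi
    rw [eval_mul, eval_C, norm_mul]
    apply mul_le_mul (hr i hi) _ (norm_nonneg _) hη
    rw [Lagrange.basis, eval_prod, norm_prod]
    have h1 : ∀ j ∈ A.erase i, ‖(Lagrange.basisDivisor ((i : ℕ) : ℂ) (j : ℂ)).eval z‖ ≤ (2 * R) / |(i : ℝ) - j| := by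
      intro j hj
      rw [Lagrange.basisDivisor, eval_mul, eval_C, eval_sub, eval_X, eval_C, norm_mul, norm_inv]
      have h3 : ‖(i : ℂ) - j‖ = |(i : ℝ) - j| := by
        rw [← Real.norm_eq_abs, ← Complex.norm_real]; push_cast; rfl
      rw [h3, inv_mul_eq_div]
      gcongr
      calc ‖z - j‖ ≤ ‖z‖ + ‖(j : ℂ)‖ := norm_sub_le _ _
        _ ≤ 2 * R := by
          have := hR j (mem_of_mem_erase hj)
          rw [Complex.norm_natCast]
          linarith
    refine (prod_le_prod (fun _ _ => norm_nonneg _) h1).trans ?_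
    rw [prod_div_distrib, prod_const, card_erase_of_mem hi]
    have h4 := fact_le_prod_abs A i hi
    have h5 : 0 < ∏ j ∈ A.erase i, |(i : ℝ) - j| := by
      apply prod_pos
      intro j hj
      have := ne_of_mem_erase hj
      apply abs_pos.mpr
      apply sub_ne_zero.mpr
      exact_mod_cast this.symm
    rw [div_le_div_iff₀ h5 (by positivity)]
    have : (4 * R) ^ (A.card - 1) = (2 * R) ^ (A.card - 1) * 2 ^ (A.card - 1) := by
      rw [← mul_pow]; ring
    rw [this, mul_assoc]
    gcongr
  refine (norm_sum_le _ _).trans ((sum_le_sum hterm).trans ?_)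
  rw [sum_const, nsmul_eq_mul]
  linarith [mul_comm η ((A.card : ℝ) * ((4 * R) ^ (A.card - 1) / (A.card - 1).factorial))]

lemma schwarz_small (A : Finset ℕ) (hA : A.Nonempty) (Q R η M : ℝ) (hQ : 0 ≤ Q) (hQR : Q < R)
    (hη : 0 ≤ η) (F : ℂ → ℂ) (hF : Differentiable ℂ F) (hAQ : ∀ i ∈ A, (i : ℝ) ≤ Q)
    (hAη : ∀ i ∈ A, ‖F i‖ ≤ η) (hM : ∀ z, ‖z‖ = R → ‖F z‖ ≤ M) (B : ℝ)
    (hB : A.card * ((4 * R) ^ (A.card - 1) / (A.card - 1).factorial) ≤ B) (z : ℂ) (hz : ‖z‖ ≤ Q) :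
    ‖F z‖ ≤ (M + η * B) * (2 * Q / (R - Q)) ^ A.card + η * B := by
  classical
  set P := Lagrange.interpolate A (fun i : ℕ => (i : ℂ)) (fun i => F i) with hP
  have hPb : ∀ w : ℂ, ‖w‖ ≤ R → ‖P.eval w‖ ≤ η * B := by
    intro w hw
    refine (interp_bound A hA R η hη _ hAη (fun i hi => (hAQ i hi).trans hQR.le) w hw).trans ?_
    gcongr
  have hinj : Set.InjOn (fun i : ℕ => (i : ℂ)) (A : Set ℕ) := fun x _ y _ h => Nat.cast_injective h
  have h1 := schwarz_zeros (A.image (fun i : ℕ => (i : ℂ))) Q R hQR hQ (fun w => F w - P.eval w) (M + η * B)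
    (hF.sub P.differentiable) ?_ ?_ z hz
  · rw [card_image_of_injOn hinj] at h1
    have h2 := hPb z (hz.trans hQR.le)
    calc ‖F z‖ = ‖(F z - P.eval z) + P.eval z‖ := by ring_nf
      _ ≤ ‖F z - P.eval z‖ + ‖P.eval z‖ := norm_add_le _ _
      _ ≤ _ := add_le_add h1 h2
  · intro a ha
    obtain ⟨i, hi, rfl⟩ := mem_image.mp ha
    refine ⟨by rw [Complex.norm_natCast]; exact hAQ i hi, ?_⟩
    rw [hP]
    have := Lagrange.eval_interpolate_at_node (r := fun i : ℕ => F i) hinj hi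
    rw [this, sub_self]
  · intro w hw
    refine (norm_sub_le _ _).trans (add_le_add (hM w hw) (hPb w hw.le))

lemma siegel_step (T S K L : ℕ) (hT : 0 < T) (hS : 0 < S) (hKL : K * L = 2 * (T * S))
    (c : ℕ → ℕ → ℕ → ℕ → ℤ) (B1 : ℝ) (hB1 : 1 ≤ B1)
    (hc : ∀ t < T, ∀ s < S, ∀ k < K, ∀ l < L, |(c t s k l : ℝ)| ≤ B1) :
    ∃ p : ℕ → ℕ → ℤ, (∃ k < K, ∃ l < L, p k l ≠ 0) ∧
      (∀ t < T, ∀ s < S, ∑ k ∈ range K, ∑ l ∈ range L, p k l * c t s k l = 0) ∧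
      (∀ k < K, ∀ l < L, |(p k l : ℝ)| ≤ K * L * B1) := by
  classical
  have hTS : 0 < T * S := Nat.mul_pos hT hS
  let A : Matrix (Fin T × Fin S) (Fin K × Fin L) ℤ := Matrix.of fun i j => c i.1 i.2 j.1 j.2
  have h1 : Fintype.card (Fin T × Fin S) < Fintype.card (Fin K × Fin L) := by
    simp only [Fintype.card_prod, Fintype.card_fin]; omega
  have h2 : 0 < Fintype.card (Fin T × Fin S) := by
    simp only [Fintype.card_prod, Fintype.card_fin]; omega
  obtain ⟨x, hx0, hAx, hxn⟩ := Int.Matrix.exists_ne_zero_int_vec_norm_le A h1 h2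
  have hexp : ((Fintype.card (Fin T × Fin S) : ℝ)) /
      ((Fintype.card (Fin K × Fin L) : ℝ) - (Fintype.card (Fin T × Fin S) : ℝ)) = 1 := by
    simp only [Fintype.card_prod, Fintype.card_fin]
    rw [hKL]
    push_cast
    have : (0 : ℝ) < T * S := by exact_mod_cast hTS
    rw [div_eq_one_iff_eq] <;> nlinarith
  rw [hexp, Real.rpow_one] at hxn
  have hAn : max 1 (@norm _ (Matrix.seminormedAddCommGroup).toNorm A) ≤ B1 := by
    apply max_le hB1
    refine (Matrix.norm_le_iff (by linarith)).mpr ?_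
    intro i j
    rw [Int.norm_eq_abs]
    exact hc _ i.1.2 _ i.2.2 _ j.1.2 _ j.2.2
  refine ⟨fun k l => if h : k < K ∧ l < L then x (⟨k, h.1⟩, ⟨l, h.2⟩) else 0, ?_, ?_, ?_⟩
  · by_contra hcon
    push Not at hcon
    apply hx0
    ext ⟨k, l⟩
    have := hcon k k.2 l l.2
    simpa using this
  · intro t ht s hs
    have := congrFun hAx (⟨t, ht⟩, ⟨s, hs⟩)
    simp only [Matrix.mulVec, dotProduct, A, Matrix.of_apply, Pi.zero_apply, Fintype.sum_prod_type] at this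
    rw [← this, Finset.sum_range]
    apply Finset.sum_congr rfl
    intro k _
    rw [Finset.sum_range]
    apply Finset.sum_congr rfl
    intro l _
    simp [mul_comm]
  · intro k hk l hl
    simp only [hk, hl, and_self, dif_pos]
    have h3 := (norm_le_pi_norm x (⟨k, hk⟩, ⟨l, hl⟩)).trans hxn
    rw [Int.norm_eq_abs] at h3
    refine h3.trans ?_
    simp only [Fintype.card_prod, Fintype.card_fin]
    push_cast
    gcongr

lemma choose_zero (K : ℕ) (p : ℕ → ℝ) (h : ∀ n : ℕ, ∑ k ∈ range K, p k * (n.choose k : ℝ) = 0) :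
    ∀ k < K, p k = 0 := by
  intro k
  induction k using Nat.strong_induction_on with
  | _ k ih =>
    intro hk
    have := h k
    rw [Finset.sum_eq_single k] at this
    · simpa using this
    · intro j hj hjk
      rcases lt_or_gt_of_ne hjk with h1 | h1
      · rw [ih j h1 (by simpa using hj)]; simp
      · rw [Nat.choose_eq_zero_of_lt h1]; simp
    · intro h; simp at h; omega

noncomputable def binP (F : Type) [Field F] (k : ℕ) : F[X] := C ((k.factorial : F)⁻¹) * descPochhammer F k

lemma binP_eval (F : Type) [Field F] [CharZero F] (k n : ℕ) : (binP F k).eval (n : F) = (n.choose k : F) := by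
  rw [binP, eval_mul, eval_C, descPochhammer_eval_eq_descFactorial, Nat.descFactorial_eq_factorial_mul_choose]
  push_cast
  rw [inv_mul_cancel_left₀]
  exact_mod_cast k.factorial_ne_zero

lemma binP_deg (k : ℕ) : (binP ℝ k).natDegree ≤ k := by
  refine (natDegree_C_mul_le _ _).trans ?_
  rw [descPochhammer_natDegree]

lemma binP_norm (k K : ℕ) (hk : k < K) (R : ℝ) (z : ℂ) (hz : ‖z‖ ≤ R) :
    ‖(binP ℂ k).eval z‖ ≤ (R + K) ^ k / k.factorial := by
  rw [binP, eval_mul, eval_C, norm_mul, norm_inv, Complex.norm_natCast, inv_mul_eq_div]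
  gcongr
  rw [descPochhammer_eval_eq_prod_range, norm_prod]
  calc ∏ j ∈ range k, ‖z - j‖ ≤ ∏ j ∈ range k, (R + K) := by
        apply prod_le_prod (fun _ _ => norm_nonneg _)
        intro j hj
        refine (norm_sub_le _ _).trans ?_
        rw [Complex.norm_natCast]
        have : (j : ℝ) ≤ K := by
          have := Finset.mem_range.mp hj
          exact_mod_cast (by omega)
        linarith
    _ = _ := by simp

lemma pow_sub_one_le (x ε : ℝ) (hx : |x - 1| ≤ ε) (hε1 : ε ≤ 1) (j : ℕ) : |x ^ j - 1| ≤ ε * 2 ^ j := by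
  have hε : 0 ≤ ε := (abs_nonneg _).trans hx
  have key : |x ^ j - 1| ≤ ε * (2 ^ j - 1) := by
    induction j with
    | zero => simp
    | succ j ih =>
      have h1 : |x| ≤ 2 := by
        have := abs_le.mp hx
        rw [abs_le]; constructor <;> linarith
      have h2 : x ^ (j + 1) - 1 = x * (x ^ j - 1) + (x - 1) := by ring
      rw [h2]
      refine (abs_add_le _ _).trans ?_
      rw [abs_mul]
      have h3 : |x| * |x ^ j - 1| ≤ 2 * (ε * (2 ^ j - 1)) := by gcongr
      rw [pow_succ]
      linarith
  nlinarith

lemma phi_term (a b u v : ℝ) (ha : 0 < a) (hu : 0 < u) (L l t s : ℕ) (hl : l < L) :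
    a ^ ((L - l) * t) * b ^ (l * t) * u ^ ((L - l) * s) * v ^ (l * s)
      = a ^ (L * t) * u ^ (L * s) * ((b / a) ^ t * (v / u) ^ s) ^ l := by
  obtain ⟨d, rfl⟩ := Nat.exists_eq_add_of_le hl.le
  have h1 : l + d - l = d := by omega
  rw [h1, div_pow, div_pow, mul_pow, div_pow, div_pow, ← pow_mul, ← pow_mul, ← pow_mul, ← pow_mul,
    add_mul, add_mul, pow_add, pow_add, mul_comm t l, mul_comm s l]
  have := (pow_pos ha (l * t)).ne'
  have := (pow_pos hu (l * s)).ne'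
  field_simp

lemma phi_coef_le (a b u v A V : ℝ) (ha : 1 ≤ a) (hb : 1 ≤ b) (hu : 1 ≤ u) (hv : 1 ≤ v)
    (haA : a ≤ A) (hbA : b ≤ A) (huV : u ≤ V) (hvV : v ≤ V) (L l t s T S : ℕ) (hl : l < L)
    (ht : t ≤ T) (hs : s ≤ S) :
    a ^ ((L - l) * t) * b ^ (l * t) * u ^ ((L - l) * s) * v ^ (l * s) ≤ A ^ (L * T) * V ^ (L * S) := by
  have hA : 1 ≤ A := ha.trans haA
  have hV : 1 ≤ V := hu.trans huV
  calc a ^ ((L - l) * t) * b ^ (l * t) * u ^ ((L - l) * s) * v ^ (l * s)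
      ≤ A ^ ((L - l) * t) * A ^ (l * t) * V ^ ((L - l) * s) * V ^ (l * s) := by gcongr
    _ = A ^ (L * t) * V ^ (L * s) := by
        rw [← pow_add, mul_assoc, ← pow_add, ← add_mul, ← add_mul, Nat.sub_add_cancel hl.le]
    _ ≤ _ := by gcongr

lemma sum2_le (K L : ℕ) (f : ℕ → ℕ → ℝ) (D : ℝ) (h : ∀ k < K, ∀ l < L, f k l ≤ D) :
    ∑ k ∈ range K, ∑ l ∈ range L, f k l ≤ K * L * D := by
  calc ∑ k ∈ range K, ∑ l ∈ range L, f k l ≤ ∑ k ∈ range K, ∑ l ∈ range L, D := by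
        apply sum_le_sum; intro k hk; apply sum_le_sum; intro l hl
        exact h k (mem_range.mp hk) l (mem_range.mp hl)
    _ = _ := by simp; ring

/-- auxiliary function -/
noncomputable def auxF (K L : ℕ) (p : ℕ → ℕ → ℤ) (lam : ℝ) (z : ℂ) : ℂ :=
  ∑ k ∈ range K, ∑ l ∈ range L, (p k l : ℂ) * (binP ℂ k).eval z * Complex.exp ((l : ℂ) * (lam : ℂ) * z)

lemma auxF_diff (K L : ℕ) (p : ℕ → ℕ → ℤ) (lam : ℝ) : Differentiable ℂ (auxF K L p lam) := by
  unfold auxF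
  refine Differentiable.fun_sum fun k _ => Differentiable.fun_sum fun l _ => ?_
  refine Differentiable.mul (Differentiable.mul (differentiable_const _) (Polynomial.differentiable _)) ?_
  fun_prop

lemma auxF_le (K L : ℕ) (p : ℕ → ℕ → ℤ) (lam : ℝ) (z : ℂ) (R D β : ℝ) (hz : ‖z‖ ≤ R)
    (hp : ∀ k < K, ∀ l < L, |(p k l : ℝ)| ≤ D)
    (hβ : ∀ k < K, (R + K) ^ k / k.factorial ≤ β) :
    ‖auxF K L p lam z‖ ≤ K * L * (D * β * Real.exp (L * |lam| * R)) := by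
  unfold auxF
  refine (norm_sum_le _ _).trans ?_
  refine (sum_le_sum fun k _ => norm_sum_le _ _).trans ?_
  apply sum2_le
  intro k hk l hl
  rw [norm_mul, norm_mul, Complex.norm_intCast]
  have hD : 0 ≤ D := (abs_nonneg _).trans (hp k hk l hl)
  have hR : 0 ≤ R := (norm_nonneg _).trans hz
  have h1 := (binP_norm k K hk R z hz).trans (hβ k hk)
  have hβ0 : 0 ≤ β := (norm_nonneg _).trans h1
  have h2 : ‖Complex.exp ((l : ℂ) * (lam : ℂ) * z)‖ ≤ Real.exp (L * |lam| * R) := by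
    rw [Complex.norm_exp]
    apply Real.exp_le_exp.mpr
    refine (Complex.re_le_norm _).trans ?_
    rw [norm_mul, norm_mul, Complex.norm_natCast, Complex.norm_real, Real.norm_eq_abs]
    gcongr
  exact mul_le_mul (mul_le_mul (hp k hk l hl) h1 (norm_nonneg _) hD) h2 (norm_nonneg _) (by positivity)

lemma auxF_nat (K L : ℕ) (p : ℕ → ℕ → ℤ) (θ : ℝ) (hθ : 0 < θ) (n : ℕ) :
    auxF K L p (Real.log θ) (n : ℂ) =
      ((∑ k ∈ range K, ∑ l ∈ range L, (p k l : ℝ) * (n.choose k : ℝ) * θ ^ (l * n) : ℝ) : ℂ) := by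
  unfold auxF
  push_cast
  refine sum_congr rfl fun k _ => sum_congr rfl fun l _ => ?_
  rw [binP_eval]
  congr 1
  have : (l : ℂ) * (Real.log θ : ℂ) * (n : ℂ) = ((l * n : ℕ) : ℂ) * (Real.log θ : ℂ) := by push_cast; ring
  rw [this, Complex.exp_nat_mul, ← Complex.ofReal_exp, Real.exp_log hθ]

lemma aux_compare (K L m t s T S : ℕ) (p : ℕ → ℕ → ℤ) (r y θ ε A D β : ℝ) (hθ : 0 < θ) (hA : 1 ≤ A)
    (hr : r ≤ A) (hθm : θ ^ m = r) (hθA : θ ≤ A)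
    (hε1 : ε ≤ 1) (hy : |y / θ - 1| ≤ ε) (ht : t ≤ T) (hs : s ≤ S)
    (hp : ∀ k < K, ∀ l < L, |(p k l : ℝ)| ≤ D)
    (hβ : ∀ k < K, ((t * m + s).choose k : ℝ) ≤ β) :
    |(∑ k ∈ range K, ∑ l ∈ range L, (p k l : ℝ) * ((t * m + s).choose k : ℝ) * θ ^ (l * (t * m + s)))
      - ∑ k ∈ range K, ∑ l ∈ range L, (p k l : ℝ) * ((t * m + s).choose k : ℝ) * (r ^ t * y ^ s) ^ l|
     ≤ K * L * (D * β * (A ^ (L * T) * (2 * A) ^ (L * S) * ε)) := by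
  have hε : 0 ≤ ε := (abs_nonneg _).trans hy
  rw [← sum_sub_distrib]
  refine (abs_sum_le_sum_abs _ _).trans ?_
  refine (sum_le_sum (g := fun k => ∑ l ∈ range L, |(p k l : ℝ) * ((t * m + s).choose k : ℝ) * θ ^ (l * (t * m + s)) - (p k l : ℝ) * ((t * m + s).choose k : ℝ) * (r ^ t * y ^ s) ^ l|) fun k _ => ?_).trans ?_
  · rw [← sum_sub_distrib]; exact abs_sum_le_sum_abs _ _
  apply sum2_le
  intro k hk l hl
  have hD : 0 ≤ D := (abs_nonneg _).trans (hp k hk l hl)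
  have hβ0 : (0 : ℝ) ≤ β := le_trans (by positivity) (hβ k hk)
  have e1 : (p k l : ℝ) * ((t * m + s).choose k : ℝ) * θ ^ (l * (t * m + s)) - (p k l : ℝ) * ((t * m + s).choose k : ℝ) * (r ^ t * y ^ s) ^ l
      = (p k l : ℝ) * ((t * m + s).choose k : ℝ) * (r ^ (l * t) * θ ^ (l * s) * -((y / θ) ^ (l * s) - 1)) := by
    have hθ' := hθ.ne'
    have e2 : θ ^ (l * (t * m + s)) = r ^ (l * t) * θ ^ (l * s) := by
      rw [← hθm, ← pow_mul, ← pow_add]; ring_nf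
    have e3 : (r ^ t * y ^ s) ^ l = r ^ (l * t) * θ ^ (l * s) * (y / θ) ^ (l * s) := by
      rw [div_pow, mul_assoc, mul_div_cancel₀ _ (by positivity), mul_pow, ← pow_mul, ← pow_mul, mul_comm t, mul_comm s]
    rw [e2, e3]; ring
  have hr0 : 0 ≤ r := by rw [← hθm]; positivity
  rw [e1, abs_mul, abs_mul, abs_mul, abs_mul, abs_neg, abs_of_nonneg (pow_nonneg hr0 _),
    abs_of_nonneg (pow_nonneg hθ.le _), Nat.abs_cast]
  have h3 := pow_sub_one_le (y / θ) ε hy hε1 (l * s)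
  have h4 : r ^ (l * t) ≤ A ^ (L * T) :=
    (pow_le_pow_left₀ hr0 hr _).trans (pow_le_pow_right₀ hA (Nat.mul_le_mul hl.le ht))
  have h5 : θ ^ (l * s) ≤ A ^ (L * S) :=
    (pow_le_pow_left₀ hθ.le hθA _).trans (pow_le_pow_right₀ hA (Nat.mul_le_mul hl.le hs))
  have h6 : (2:ℝ) ^ (l * s) ≤ 2 ^ (L * S) := pow_le_pow_right₀ (by norm_num) (Nat.mul_le_mul hl.le hs)
  have h7 : |(y / θ) ^ (l * s) - 1| ≤ ε * 2 ^ (L * S) := h3.trans (by gcongr)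
  calc |(p k l : ℝ)| * ((t * m + s).choose k : ℝ) * (r ^ (l * t) * θ ^ (l * s) * |(y / θ) ^ (l * s) - 1|)
      ≤ D * β * (A ^ (L * T) * A ^ (L * S) * (ε * 2 ^ (L * S))) := by
        gcongr
        · exact hp k hk l hl
        · exact hβ k hk
    _ = _ := by rw [mul_pow]; ring

set_option maxHeartbeats 2000000 in
lemma baker_core (a b u v m K L T S : ℕ) (A V θ ε Q R E β B : ℝ)
    (ha : 1 ≤ a) (hb : 1 ≤ b) (hu : 1 ≤ u) (hv : 1 ≤ v) (haA : (a : ℝ) ≤ A) (hbA : (b : ℝ) ≤ A)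
    (huV : (u : ℝ) ≤ V) (hvV : (v : ℝ) ≤ V) (huv : u ≠ v) (hT : 0 < T) (hS : 0 < S)
    (hSm : S ≤ m) (hKL : K * L = 2 * (T * S)) (hθ : 0 < θ) (hθm : θ ^ m = (b : ℝ) / a)
    (hε1 : ε ≤ 1) (hε : |(v : ℝ) / u / θ - 1| ≤ ε)
    (hQ : Q = 2 * T * m + S + L) (hQR : Q < R) (hE : 1 ≤ E) (hQE : 2 * Q / (R - Q) ≤ 1 / E)
    (hβ1 : 1 ≤ β) (hβ : ∀ k < K, (R + K) ^ k / k.factorial ≤ β)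
    (hB1 : 1 ≤ B) (hB : (T * S : ℕ) * ((4 * R) ^ (T * S - 1) / (T * S - 1).factorial) ≤ B)
    (H1 : 2 * (A ^ (2 * L * T) * V ^ (L * (S + L)) * (K * L * (K * L * (β * A ^ (L * T) * V ^ (L * S)) * β * Real.exp (L * |Real.log θ| * R)))) < E ^ (T * S))
    (H2 : 6 * (A ^ (2 * L * T) * V ^ (L * (S + L)) * (K * L * (K * L * (β * A ^ (L * T) * V ^ (L * S)) * β * (A ^ (L * (2 * T)) * (2 * A) ^ (L * (S + L)) * ε)) * B)) ≤ 1) :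
    False := by
  have ha' : (1 : ℝ) ≤ a := by exact_mod_cast ha
  have hb' : (1 : ℝ) ≤ b := by exact_mod_cast hb
  have hu' : (1 : ℝ) ≤ u := by exact_mod_cast hu
  have hv' : (1 : ℝ) ≤ v := by exact_mod_cast hv
  have hA1 : 1 ≤ A := ha'.trans haA
  have hV1 : 1 ≤ V := hu'.trans huV
  have hm0 : 0 < m := by omega
  have hTS : 0 < T * S := Nat.mul_pos hT hS
  have hr : (b : ℝ) / a ≤ A := by
    rw [div_le_iff₀ (by linarith)]; nlinarith
  have hr0 : 0 < (b : ℝ) / a := by positivity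
  have hθA : θ ≤ A := by
    by_contra hcon
    push Not at hcon
    have h1 : A ^ m < θ ^ m := pow_lt_pow_left₀ hcon (by linarith) (by omega)
    have h2 : A ≤ A ^ m := le_self_pow₀ hA1 (by omega)
    rw [hθm] at h1
    linarith
  have hε0 : 0 ≤ ε := (abs_nonneg _).trans hε
  have hQ0 : 0 ≤ Q := by rw [hQ]; positivity
  set B1 : ℝ := β * A ^ (L * T) * V ^ (L * S) with hB1def
  have hB11 : 1 ≤ B1 := by
    have h1 := one_le_pow₀ hA1 (n := L * T)
    have h2 := one_le_pow₀ hV1 (n := L * S)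
    have h3 : 1 ≤ β * A ^ (L * T) := one_le_mul_of_one_le_of_one_le hβ1 h1
    exact one_le_mul_of_one_le_of_one_le h3 h2
  have hnQ : ∀ t < 2 * T, ∀ s < S + L, ((t * m + s : ℕ) : ℝ) ≤ Q := by
    intro t ht s hs
    rw [hQ]
    have : t * m ≤ 2 * T * m := Nat.mul_le_mul_right _ ht.le
    exact_mod_cast (by omega : t * m + s ≤ 2 * T * m + S + L)
  have hchoose : ∀ t < 2 * T, ∀ s < S + L, ∀ k < K, ((t * m + s).choose k : ℝ) ≤ β := by
    intro t ht s hs k hk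
    have h1 := (binP_norm k K hk R ((t * m + s : ℕ) : ℂ) (by
      rw [Complex.norm_natCast]; exact (hnQ t ht s hs).trans hQR.le)).trans (hβ k hk)
    rwa [binP_eval, Complex.norm_natCast] at h1
  -- Siegel
  obtain ⟨p, ⟨k0, hk0, l0, hl0, hp0⟩, hpz, hpb⟩ := siegel_step T S K L hT hS hKL
    (fun t s k l => ((t * m + s).choose k : ℤ) * ((a : ℤ) ^ ((L - l) * t) * (b : ℤ) ^ (l * t) * (u : ℤ) ^ ((L - l) * s) * (v : ℤ) ^ (l * s)))
    B1 hB11 (by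
      intro t ht s hs k hk l hl
      push_cast
      rw [abs_of_nonneg (by positivity), hB1def, mul_assoc β]
      exact mul_le_mul (hchoose t (by omega) s (by omega) k hk)
        (phi_coef_le a b u v A V ha' hb' hu' hv' haA hbA huV hvV L l t s T S hl ht.le hs.le) (by positivity) (by linarith))
  set r : ℝ := (b : ℝ) / a with hrdef
  set y : ℝ := (v : ℝ) / u with hydef
  let Φ : ℕ → ℕ → ℤ := fun t s => ∑ k ∈ range K, ∑ l ∈ range L, p k l * (((t * m + s).choose k : ℤ) * ((a : ℤ) ^ ((L - l) * t) * (b : ℤ) ^ (l * t) * (u : ℤ) ^ ((L - l) * s) * (v : ℤ) ^ (l * s)))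
  let G : ℕ → ℕ → ℝ := fun t s => ∑ k ∈ range K, ∑ l ∈ range L, (p k l : ℝ) * ((t * m + s).choose k : ℝ) * (r ^ t * y ^ s) ^ l
  have hΦG : ∀ t s, (Φ t s : ℝ) = (a : ℝ) ^ (L * t) * (u : ℝ) ^ (L * s) * G t s := by
    intro t s
    simp only [Φ, G]
    push_cast
    rw [mul_sum]
    refine sum_congr rfl fun k _ => ?_
    rw [mul_sum]
    refine sum_congr rfl fun l hl => ?_
    rw [phi_term a b u v (by linarith) (by linarith) L l t s (mem_range.mp hl)]
    ring
  have hΦz : ∀ t < T, ∀ s < S, Φ t s = 0 := hpz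
  have hau : ∀ t s, 0 < (a : ℝ) ^ (L * t) * (u : ℝ) ^ (L * s) := by intro t s; positivity
  have hGz : ∀ t s, Φ t s = 0 → G t s = 0 := by
    intro t s h
    have := hΦG t s
    rw [h] at this
    push_cast at this
    have h2 := (hau t s).ne'
    rcases mul_eq_zero.mp this.symm with h | h
    · exact absurd h h2
    · exact h
  set N : ℝ := K * L with hN
  set η : ℝ := N * (N * B1 * β * (A ^ (L * (2 * T)) * (2 * A) ^ (L * (S + L)) * ε)) with hη
  have hN0 : 0 ≤ N := by positivity
  have hη0 : 0 ≤ η := by positivity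
  set F := auxF K L p (Real.log θ) with hF
  have hFG : ∀ t < 2 * T, ∀ s < S + L, ‖F ((t * m + s : ℕ) : ℂ) - (G t s : ℂ)‖ ≤ η := by
    intro t ht s hs
    rw [hF, auxF_nat K L p θ hθ, ← Complex.ofReal_sub, Complex.norm_real, Real.norm_eq_abs]
    exact aux_compare K L m t s (2 * T) (S + L) p r y θ ε A (N * B1) β hθ hA1 hr hθm hθA hε1 hε ht.le hs.le hpb
      (hchoose t ht s hs)
  set M : ℝ := N * (N * B1 * β * Real.exp (L * |Real.log θ| * R)) with hM
  have hM0 : 0 ≤ M := by positivity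
  let AA : Finset ℕ := ((range T) ×ˢ (range S)).image fun q => q.1 * m + q.2
  have hAAcard : AA.card = T * S := by
    rw [Finset.card_image_of_injOn]
    · simp
    · rintro ⟨t, s⟩ h1 ⟨t', s'⟩ h2 h3
      simp only [coe_product, Set.mem_prod, mem_coe, mem_range] at h1 h2 h3
      have e1 : t = t' := by
        have := congrArg (· / m) h3
        rw [add_comm, Nat.add_mul_div_right _ _ hm0, add_comm (t' * m), Nat.add_mul_div_right _ _ hm0, Nat.div_eq_of_lt (by omega), Nat.div_eq_of_lt (by omega)] at this
        omega
      subst e1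
      simp at h3
      rw [h3]
  have hmem : ∀ i ∈ AA, ∃ t < T, ∃ s < S, i = t * m + s := by
    intro i hi
    simp only [AA, mem_image, mem_product, mem_range, Prod.exists] at hi
    obtain ⟨t, s, ⟨h1, h2⟩, h3⟩ := hi
    exact ⟨t, h1, s, h2, h3.symm⟩
  have hsmall : ∀ t < 2 * T, ∀ s < S + L, ‖F ((t * m + s : ℕ) : ℂ)‖ ≤ (M + η * B) * (1 / E) ^ (T * S) + η * B := by
    intro t ht s hs
    have := schwarz_small AA (by rw [← Finset.card_pos, hAAcard]; exact hTS) Q R η M hQ0 hQR hη0 F (auxF_diff _ _ _ _)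
      (by
        intro i hi
        obtain ⟨t, ht, s, hs, rfl⟩ := hmem i hi
        exact hnQ t (by omega) s (by omega))
      (by
        intro i hi
        obtain ⟨t, ht, s, hs, rfl⟩ := hmem i hi
        have h1 := hFG t (by omega) s (by omega)
        rw [hGz t s (hΦz t ht s hs)] at h1
        simpa using h1)
      (by
        intro z hz
        exact auxF_le K L p _ z R (N * B1) β hz.le hpb hβ)
      B (by rw [hAAcard]; exact hB) ((t * m + s : ℕ) : ℂ)
      (by rw [Complex.norm_natCast]; exact hnQ t ht s hs)
    rw [hAAcard] at this
    refine this.trans ?_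
    have h0 : 0 ≤ 2 * Q / (R - Q) := div_nonneg (by linarith) (by linarith)
    gcongr
  have hΦall : ∀ t < 2 * T, ∀ s < S + L, Φ t s = 0 := by
    intro t ht s hs
    have h1 : |G t s| ≤ M / E ^ (T * S) + 3 * (η * B) := by
      have e1 : ‖(G t s : ℂ)‖ ≤ ‖F ((t * m + s : ℕ) : ℂ)‖ + ‖F ((t * m + s : ℕ) : ℂ) - (G t s : ℂ)‖ := by
        have := norm_sub_le (F ((t * m + s : ℕ) : ℂ)) (F ((t * m + s : ℕ) : ℂ) - (G t s : ℂ))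
        simpa using this
      rw [Complex.norm_real, Real.norm_eq_abs] at e1
      have e2 := hFG t ht s hs
      have e3 := hsmall t ht s hs
      have e4 : η ≤ η * B := le_mul_of_one_le_right hη0 hB1
      have e5 : (1 / E) ^ (T * S) ≤ 1 := pow_le_one₀ (by positivity) (by rw [div_le_one (by linarith)]; exact hE)
      have e6 : η * B * (1 / E) ^ (T * S) ≤ η * B := mul_le_of_le_one_right (by positivity) e5
      have e7 : M * (1 / E) ^ (T * S) = M / E ^ (T * S) := by rw [div_pow, one_pow]; ring
      nlinarith
    have h2 : (a : ℝ) ^ (L * t) * (u : ℝ) ^ (L * s) ≤ A ^ (2 * L * T) * V ^ (L * (S + L)) := by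
      have e1 : L * t ≤ 2 * L * T := by
        calc L * t ≤ L * (2 * T) := Nat.mul_le_mul_left _ ht.le
          _ = _ := by ring
      have e2 : L * s ≤ L * (S + L) := Nat.mul_le_mul_left _ hs.le
      have e3 : (a : ℝ) ^ (L * t) ≤ A ^ (2 * L * T) :=
        (pow_le_pow_left₀ (by linarith) haA _).trans (pow_le_pow_right₀ hA1 e1)
      have e4 : (u : ℝ) ^ (L * s) ≤ V ^ (L * (S + L)) :=
        (pow_le_pow_left₀ (by linarith) huV _).trans (pow_le_pow_right₀ hV1 e2)
      gcongr
    have h3 : |(Φ t s : ℝ)| < 1 := by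
      rw [hΦG, abs_mul, abs_of_pos (hau t s)]
      refine lt_of_le_of_lt (mul_le_mul h2 h1 (abs_nonneg _) (by positivity)) ?_
      set W := A ^ (2 * L * T) * V ^ (L * (S + L)) with hW
      have hEp : 0 < E ^ (T * S) := by positivity
      have e1 : W * (M / E ^ (T * S)) < 1 / 2 := by
        rw [← mul_div_assoc, div_lt_iff₀ hEp]
        linarith
      have e2 : W * (3 * (η * B)) ≤ 1 / 2 := by linarith
      linarith
    have h4 : |Φ t s| < 1 := by exact_mod_cast h3
    exact Int.abs_lt_one_iff.mp h4
  -- zero estimate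
  let P : ℕ → ℝ[X] := fun l => ∑ k ∈ range K, C (p k l : ℝ) * binP ℝ k
  have hK0 : 0 < K := by omega
  have hP := zero_est K L m (2 * T) S r y hr0 (by positivity) (by
      intro h
      rw [hydef, div_eq_one_iff_eq (by positivity)] at h
      exact huv (by exact_mod_cast h.symm)) P
    (by
      intro l hl
      refine lt_of_le_of_lt (natDegree_sum_le_of_forall_le (n := K - 1) _ _ ?_) (by omega)
      intro k hk
      have := mem_range.mp hk
      exact ((natDegree_C_mul_le _ _).trans (binP_deg k)).trans (by omega))
    hSm (by rw [hKL]; exact le_of_eq (by ring))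
    (by
      intro t ht s hs
      have h1 := hGz t s (hΦall t ht s hs)
      rw [← h1]
      simp only [G, P]
      rw [sum_comm]
      refine sum_congr rfl fun l _ => ?_
      rw [eval_finsetSum, sum_mul]
      refine sum_congr rfl fun k _ => ?_
      rw [eval_mul, eval_C, binP_eval])
  have := choose_zero K (fun k => (p k l0 : ℝ)) (by
    intro n
    have h1 := congrArg (fun q => eval (n : ℝ) q) (hP l0 hl0)
    simp only [P, eval_finsetSum, eval_mul, eval_C, binP_eval, eval_zero] at h1
    exact h1) k0 hk0
  exact hp0 (by exact_mod_cast this)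

lemma abs_sub_one_le_pow (x : ℝ) (hx : 0 ≤ x) (m : ℕ) (hm : 1 ≤ m) : |x - 1| ≤ |x ^ m - 1| := by
  rcases le_total x 1 with h | h
  · have h1 : x ^ m ≤ x := pow_le_of_le_one hx h (by omega)
    rw [abs_of_nonpos (by linarith), abs_of_nonpos (by linarith)]
    linarith
  · have h1 : x ≤ x ^ m := le_self_pow₀ h (by omega)
    rw [abs_of_nonneg (by linarith), abs_of_nonneg (by linarith)]
    linarith

lemma theta_exists (g a b m : ℕ) (ha : 1 ≤ a) (hb : 1 ≤ b) (haA : a ≤ 2 ^ g) (hbA : b ≤ 2 ^ g) (hm : 1 ≤ m) :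
    ∃ θ : ℝ, 0 < θ ∧ θ ^ m = (b : ℝ) / a ∧ m * |Real.log θ| ≤ g := by
  have ha' : (1 : ℝ) ≤ a := by exact_mod_cast ha
  have hb' : (1 : ℝ) ≤ b := by exact_mod_cast hb
  have hr : 0 < (b : ℝ) / a := by positivity
  refine ⟨((b : ℝ) / a) ^ ((m : ℝ)⁻¹), by positivity, Real.rpow_inv_natCast_pow hr.le (by omega), ?_⟩
  rw [Real.log_rpow hr, abs_mul, abs_of_nonneg (by positivity), ← mul_assoc,
    mul_inv_cancel₀ (by positivity), one_mul, Real.log_div (by positivity) (by positivity)]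
  have key : ∀ x : ℕ, 1 ≤ x → x ≤ 2 ^ g → 0 ≤ Real.log x ∧ Real.log x ≤ g := by
    intro x hx hxg
    refine ⟨Real.log_nonneg (by exact_mod_cast hx), ?_⟩
    calc Real.log x ≤ Real.log ((2 : ℝ) ^ g) := Real.log_le_log (by exact_mod_cast hx) (by exact_mod_cast hxg)
      _ = g * Real.log 2 := by rw [Real.log_pow]
      _ ≤ g * 1 := by
        gcongr
        have := Real.log_two_lt_d9
        linarith
      _ = g := mul_one _
  have h1 := key a ha haA
  have h2 := key b hb hbA
  rw [abs_le]; constructor <;> linarith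

lemma eps_bound (g a b u v m : ℕ) (hb : 1 ≤ b) (ha : 1 ≤ a) (hu : 1 ≤ u) (hm : 1 ≤ m) (θ : ℝ) (hθ : 0 < θ)
    (hθm : θ ^ m = (b : ℝ) / a) (h : |(a : ℝ) * v ^ m - b * u ^ m| ≤ 2 ^ g) :
    |(v : ℝ) / u / θ - 1| ≤ 2 ^ g / (u : ℝ) ^ m := by
  refine (abs_sub_one_le_pow _ (by positivity) m hm).trans ?_
  have ha' : (1 : ℝ) ≤ a := by exact_mod_cast ha
  have hb' : (1 : ℝ) ≤ b := by exact_mod_cast hb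
  have hu' : (1 : ℝ) ≤ u := by exact_mod_cast hu
  have hU : 0 < (u : ℝ) ^ m := by positivity
  rw [div_pow, div_pow, hθm]
  have e : (v : ℝ) ^ m / u ^ m / (b / a) - 1 = (a * v ^ m - b * u ^ m) / (b * u ^ m) := by
    field_simp
  rw [e, abs_div, abs_of_pos (by positivity : (0:ℝ) < b * u ^ m)]
  gcongr
  nlinarith

lemma pow_div_fact_le (x : ℝ) (N k : ℕ) (hx1 : 1 ≤ x) (hk : k ≤ N) :
    ((N : ℝ) * x) ^ k / k.factorial ≤ (3 * x) ^ N := by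
  rw [mul_pow, mul_pow, mul_div_right_comm]
  have h1 : (N : ℝ) ^ k / k.factorial ≤ 3 ^ N := by
    refine (Real.pow_div_factorial_le_exp (N : ℝ) (by positivity) k).trans ?_
    have : Real.exp (N : ℝ) = Real.exp 1 ^ N := by rw [← Real.exp_nat_mul, mul_one]
    rw [this]
    have := Real.exp_one_lt_d9
    gcongr
    linarith
  have h2 : x ^ k ≤ x ^ N := pow_le_pow_right₀ hx1 hk
  gcongr


lemma combo1 (D F a1 v1 N β a2 v2 e : ℝ) (hD : 2 ≤ D) (hF : D ^ 92 ≤ F) (hN0 : 0 ≤ N) (hβ0 : 0 ≤ β)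
    (ha10 : 0 ≤ a1) (hv10 : 0 ≤ v1) (ha20 : 0 ≤ a2) (hv20 : 0 ≤ v2) (he0 : 0 ≤ e)
    (ha1 : a1 ≤ D ^ 2) (hv1 : v1 ≤ D ^ 64) (hN : N ≤ D ^ 32) (hβ : β ≤ D ^ 8 * F) (ha2 : a2 ≤ D) (hv2 : v2 ≤ D ^ 32)
    (he : e ≤ D ^ 2) :
    2 * (a1 * v1 * (N * (N * (β * a2 * v2) * β * e))) < F ^ 4 := by
  have hD0 : 0 < D := by linarith
  have hF0 : 0 < F := lt_of_lt_of_le (by positivity) hF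
  calc 2 * (a1 * v1 * (N * (N * (β * a2 * v2) * β * e)))
      ≤ D * (D ^ 2 * D ^ 64 * (D ^ 32 * (D ^ 32 * ((D ^ 8 * F) * D * D ^ 32) * (D ^ 8 * F) * D ^ 2))) := by gcongr
    _ = D ^ 182 * F ^ 2 := by ring
    _ < D ^ 184 * F ^ 2 := by
        have : D ^ 182 < D ^ 184 := pow_lt_pow_right₀ (by linarith) (by norm_num)
        gcongr
    _ = (D ^ 92) ^ 2 * F ^ 2 := by ring
    _ ≤ F ^ 2 * F ^ 2 := by gcongr
    _ = F ^ 4 := by ring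

lemma combo2 (g : ℕ) (hg : 1 ≤ g) (D F a1 v1 N β a2 v2 a3 q w B U : ℝ) (hD : 2 ≤ D) (hF : 0 ≤ F) (hN0 : 0 ≤ N) (hβ0 : 0 ≤ β)
    (ha10 : 0 ≤ a1) (hv10 : 0 ≤ v1) (ha20 : 0 ≤ a2) (hv20 : 0 ≤ v2) (ha30 : 0 ≤ a3) (hq0 : 0 ≤ q) (hw0 : 0 ≤ w) (hB0 : 0 ≤ B)
    (hU : 0 < U) (hw : w ≤ D ^ g)
    (ha1 : a1 ≤ D ^ 2) (hv1 : v1 ≤ D ^ 64) (hN : N ≤ D ^ 32) (hβ : β ≤ D ^ 8 * F) (ha2 : a2 ≤ D) (hv2 : v2 ≤ D ^ 32)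
    (ha3 : a3 ≤ D ^ 2) (hq : q ≤ D ^ (64 * g)) (hB : B ≤ D ^ 80 * F ^ 8) (hUU : D ^ (329 * g) * F ^ 10 ≤ U) :
    6 * (a1 * v1 * (N * (N * (β * a2 * v2) * β * (a3 * q * (w / U))) * B)) ≤ 1 := by
  have hD0 : 0 < D := by linarith
  have h6 : 6 ≤ D ^ 3 := by
    have : (2:ℝ) ^ 3 ≤ D ^ 3 := by gcongr
    linarith
  calc 6 * (a1 * v1 * (N * (N * (β * a2 * v2) * β * (a3 * q * (w / U))) * B))
      ≤ D ^ 3 * (D ^ 2 * D ^ 64 * (D ^ 32 * (D ^ 32 * ((D ^ 8 * F) * D * D ^ 32) * (D ^ 8 * F) * (D ^ 2 * D ^ (64 * g) * (D ^ g / U))) * (D ^ 80 * F ^ 8))) := by gcongr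
    _ = D ^ (264 + 65 * g) * F ^ 10 / U := by
        rw [show 264 + 65 * g = 264 + 64 * g + g by ring, pow_add D (264 + 64 * g), pow_add D 264]; ring
    _ ≤ D ^ (329 * g) * F ^ 10 / U := by
        gcongr
        · linarith
        · omega
    _ ≤ 1 := by rw [div_le_one hU]; exact hUU

set_option maxHeartbeats 4000000 in
lemma baker_fixed (g a b u v m E τ : ℕ) (hg : 1 ≤ g) (ha : 1 ≤ a) (hb : 1 ≤ b) (haA : a ≤ 2 ^ g) (hbA : b ≤ 2 ^ g)
    (hu : 2 ≤ u) (hv : 1 ≤ v) (huv : u ≠ v) (hE1 : E * E ≤ m) (hE2 : m ≤ 4 * (E * E)) (hE3 : 2 ^ 23 ≤ E) (hE4 : 2304 * g ≤ E)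
    (hE5 : (2 ^ (658 * g) * E ^ 80) ^ (2304 * g) ≤ 2 ^ E) (hτ1 : u < 2 ^ τ) (hτ2 : 2 ^ τ ≤ 2 * u)
    (hv2 : v ≤ 2 * u) (h : |(a : ℝ) * v ^ m - b * u ^ m| ≤ 2 ^ g) : False := by
  have hτ0 : 2 ≤ τ := by
    by_contra hcon
    have : 2 ^ τ ≤ 2 ^ 1 := Nat.pow_le_pow_right (by norm_num) (by omega)
    omega
  have hm0 : 1 ≤ m := by nlinarith
  obtain ⟨S, hS⟩ : ∃ S, S = 2304 * g * E := ⟨_, rfl⟩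
  obtain ⟨X, hX⟩ : ∃ X, X = τ * S := ⟨_, rfl⟩
  have hSm : S ≤ m := by rw [hS]; nlinarith
  have hES : E ≤ S := by rw [hS]; nlinarith
  have hE1' : 1 ≤ E := le_trans (by norm_num) hE3
  have hgS : 2304 * g ≤ S := by rw [hS]; exact Nat.le_mul_of_pos_right _ (by omega)
  have hSX : 2 * S ≤ X := by rw [hX]; exact Nat.mul_le_mul_right _ hτ0
  have hgX : 2304 * g * τ ≤ X := by rw [hX, mul_comm τ]; exact Nat.mul_le_mul_right _ hgS
  have hX1 : 1 ≤ X := by omega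
  obtain ⟨θ, hθ, hθm, hθl⟩ := theta_exists g a b m ha hb haA hbA hm0
  have hε := eps_bound g a b u v m hb ha (by omega) hm0 θ hθ hθm h
  have hER : (2:ℝ) ^ 23 ≤ E := by exact_mod_cast hE3
  have hE1R : (1:ℝ) ≤ E := by exact_mod_cast hE1'
  have hmR : (1:ℝ) ≤ m := by exact_mod_cast hm0
  have hSR : (S : ℝ) = 2304 * g * E := by rw [hS]; push_cast; ring
  have hXR : (X : ℝ) = τ * (2304 * g * E) := by rw [hX]; push_cast; rw [hSR]
  have hgR : (1:ℝ) ≤ g := by exact_mod_cast hg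
  have hτR : (2:ℝ) ≤ τ := by exact_mod_cast hτ0
  have hSmR : (S:ℝ) ≤ m := by exact_mod_cast hSm
  have hm16 : (16:ℝ) ≤ m := by
    have : 16 ≤ m := by omega
    exact_mod_cast this
  obtain ⟨Q, hQ⟩ : ∃ Q : ℝ, Q = 2 * (16 * τ : ℕ) * m + S + (16 : ℕ) := ⟨_, rfl⟩
  obtain ⟨R, hR⟩ : ∃ R : ℝ, R = (1 + 2 * E) * Q := ⟨_, rfl⟩
  have hQ34 : Q ≤ 34 * (τ * m) := by
    rw [hQ]; push_cast; nlinarith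
  have hQ0 : 0 < Q := by rw [hQ]; positivity
  have hR102 : R ≤ 102 * (τ * m * E) := by
    rw [hR]
    calc (1 + 2 * E) * Q ≤ (3 * E) * (34 * (τ * m)) := by gcongr; linarith
      _ = _ := by ring
  have hR0 : 0 < R := by rw [hR]; positivity
  have hgτE : (τ * E : ℝ) ≤ τ * g * E := by
    have : (τ : ℝ) * 1 ≤ τ * g := by gcongr
    nlinarith
  have hτmE : (τ * m * E : ℝ) ≤ τ * g * E * m := by nlinarith
  have hXm : (X : ℝ) * m = 2304 * (τ * g * E * m) := by rw [hXR]; ring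
  have hτgE0 : 0 ≤ (τ * g * E * m : ℝ) := by positivity
  have hRK : R + ((2 * X : ℕ) : ℝ) ≤ ((2 * X : ℕ) : ℝ) * m := by
    push_cast
    have h1 : (X : ℝ) * 16 ≤ X * m := by gcongr
    nlinarith
  have h4R : 4 * R ≤ ((16 * X : ℕ) : ℝ) * m := by
    push_cast; nlinarith
  set D : ℝ := 2 ^ X with hD
  set F : ℝ := (E : ℝ) ^ (4 * X) with hF
  have hD2 : 2 ≤ D := by rw [hD]; exact le_self_pow₀ (by norm_num) (by omega)
  have hF92 : D ^ 92 ≤ F := by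
    rw [hD, hF, ← pow_mul, show X * 92 = 23 * (4 * X) by ring, pow_mul]
    gcongr
  have hm4 : (m : ℝ) ≤ 4 * (E * E) := by exact_mod_cast hE2
  have hβF : (3 * (m : ℝ)) ^ (2 * X) ≤ D ^ 8 * F := by
    calc (3 * (m : ℝ)) ^ (2 * X) ≤ (4 * (4 * (E * E))) ^ (2 * X) := by gcongr; norm_num
      _ = ((2 : ℝ) ^ 4 * E ^ 2) ^ (2 * X) := by congr 1; ring
      _ = D ^ 8 * F := by
        rw [hD, hF, mul_pow, ← pow_mul, ← pow_mul, ← pow_mul]; congr 2 <;> ring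
  have hBF : (6 * (m : ℝ)) ^ (16 * X) ≤ D ^ 80 * F ^ 8 := by
    calc (6 * (m : ℝ)) ^ (16 * X) ≤ (8 * (4 * (E * E))) ^ (16 * X) := by gcongr; norm_num
      _ = ((2 : ℝ) ^ 5 * E ^ 2) ^ (16 * X) := by congr 1; ring
      _ = D ^ 80 * F ^ 8 := by
        rw [hD, hF, mul_pow, ← pow_mul, ← pow_mul, ← pow_mul, ← pow_mul]; congr 2 <;> ring
  have two_pow : ∀ i j : ℕ, i ≤ X * j → (2 : ℝ) ^ i ≤ D ^ j := by
    intro i j hij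
    rw [hD, ← pow_mul]
    exact pow_le_pow_right₀ (by norm_num) hij
  have hN : ((2 * X : ℕ) : ℝ) * (16 : ℕ) ≤ D ^ 32 := by
    refine le_trans ?_ (two_pow (32 * X) 32 (by omega))
    have : 32 * X < 2 ^ (32 * X) := Nat.lt_two_pow_self
    have h2 : ((32 * X : ℕ) : ℝ) ≤ 2 ^ (32 * X) := by exact_mod_cast this.le
    push_cast at h2 ⊢
    linarith
  have hA1 : (2 ^ g : ℝ) ^ (2 * 16 * (16 * τ)) ≤ D ^ 2 := by
    rw [← pow_mul]; apply two_pow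
    refine le_trans (le_trans (le_of_eq (by ring : _ = (g * τ) * 512)) ?_) (Nat.mul_le_mul_right 2 hgX)
    rw [show 2304 * g * τ * 2 = (g * τ) * (2304 * 2) by ring]
    exact Nat.mul_le_mul_left _ (by norm_num)
  have hA2 : (2 ^ g : ℝ) ^ (16 * (16 * τ)) ≤ D := by
    rw [← pow_mul, ← pow_one D]; apply two_pow
    refine le_trans (le_trans (le_of_eq (by ring : _ = (g * τ) * 256)) ?_) (Nat.mul_le_mul_right 1 hgX)
    rw [show 2304 * g * τ * 1 = (g * τ) * (2304 * 1) by ring]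
    exact Nat.mul_le_mul_left _ (by norm_num)
  have hA3 : (2 ^ g : ℝ) ^ (16 * (2 * (16 * τ))) ≤ D ^ 2 := by
    rw [← pow_mul]; apply two_pow
    refine le_trans (le_trans (le_of_eq (by ring : _ = (g * τ) * 512)) ?_) (Nat.mul_le_mul_right 2 hgX)
    rw [show 2304 * g * τ * 2 = (g * τ) * (2304 * 2) by ring]
    exact Nat.mul_le_mul_left _ (by norm_num)
  have hV1 : (4 ^ τ : ℝ) ^ (16 * (S + 16)) ≤ D ^ 64 := by
    rw [show (4:ℝ) = 2 ^ 2 by norm_num, ← pow_mul, ← pow_mul]; apply two_pow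
    rw [hX]
    have h16 : S + 16 ≤ 2 * S := by omega
    calc 2 * (τ * (16 * (S + 16))) ≤ 2 * (τ * (16 * (2 * S))) := by gcongr
      _ = τ * S * 64 := by ring
  have hV2 : (4 ^ τ : ℝ) ^ (16 * S) ≤ D ^ 32 := by
    rw [show (4:ℝ) = 2 ^ 2 by norm_num, ← pow_mul, ← pow_mul]; apply two_pow
    rw [hX]
    exact le_of_eq (by ring)
  have hq : (2 * 2 ^ g : ℝ) ^ (16 * (S + 16)) ≤ D ^ (64 * g) := by
    rw [← pow_succ', ← pow_mul]; apply two_pow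
    have h1 : 16 * (S + 16) ≤ 32 * S := by omega
    calc (g + 1) * (16 * (S + 16)) ≤ (2 * g) * (32 * S) := Nat.mul_le_mul (by omega) h1
      _ = S * (64 * g) := by ring
      _ ≤ X * (64 * g) := Nat.mul_le_mul_right _ (by omega)
  have he : Real.exp ((16 : ℕ) * |Real.log θ| * R) ≤ D ^ 2 := by
    have h1 : ((16 : ℕ) : ℝ) * |Real.log θ| * R ≤ X := by
      have e0 : 0 ≤ |Real.log θ| := abs_nonneg _
      calc ((16 : ℕ) : ℝ) * |Real.log θ| * R ≤ 16 * |Real.log θ| * (102 * (τ * m * E)) := by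
            push_cast; gcongr
        _ = 1632 * (τ * E) * (m * |Real.log θ|) := by ring
        _ ≤ 1632 * (τ * E) * g := by gcongr
        _ ≤ X := by
          have e1 : 0 ≤ (τ * E * g : ℝ) := by positivity
          have e2 : (τ : ℝ) * (2304 * g * E) = 1632 * (τ * E) * g + 672 * (τ * E * g) := by ring
          rw [hXR, e2]
          exact le_add_of_nonneg_right (mul_nonneg (by norm_num) e1)
    calc Real.exp ((16 : ℕ) * |Real.log θ| * R) ≤ Real.exp X := Real.exp_le_exp.mpr h1
      _ = Real.exp 1 ^ X := by rw [← Real.exp_nat_mul, mul_one]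
      _ ≤ (2 ^ 2) ^ X := by
        have := Real.exp_one_lt_d9
        gcongr
        linarith
      _ = D ^ 2 := by rw [hD, ← pow_mul, ← pow_mul, mul_comm]
  have hUU : D ^ (329 * g) * F ^ 10 ≤ (u : ℝ) ^ m := by
    have e1 : (2 ^ (658 * g) * E ^ 80) ^ S ≤ 2 ^ m := by
      calc (2 ^ (658 * g) * E ^ 80) ^ S = ((2 ^ (658 * g) * E ^ 80) ^ (2304 * g)) ^ E := by rw [hS, ← pow_mul]
        _ ≤ (2 ^ E) ^ E := Nat.pow_le_pow_left hE5 _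
        _ = 2 ^ (E * E) := by rw [← pow_mul]
        _ ≤ 2 ^ m := Nat.pow_le_pow_right (by norm_num) hE1
    have e2 : 2 ^ τ ≤ u ^ 2 := by nlinarith
    have e3 : (2 ^ (658 * g) * E ^ 80) ^ X ≤ (u ^ m) ^ 2 := by
      calc (2 ^ (658 * g) * E ^ 80) ^ X = ((2 ^ (658 * g) * E ^ 80) ^ S) ^ τ := by rw [hX, ← pow_mul, mul_comm S]
        _ ≤ (2 ^ m) ^ τ := Nat.pow_le_pow_left e1 _
        _ = (2 ^ τ) ^ m := by rw [← pow_mul, ← pow_mul, mul_comm]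
        _ ≤ (u ^ 2) ^ m := Nat.pow_le_pow_left e2 _
        _ = (u ^ m) ^ 2 := by rw [← pow_mul, ← pow_mul, mul_comm]
    have e4 : ((2:ℝ) ^ (658 * g) * E ^ 80) ^ X ≤ ((u:ℝ) ^ m) ^ 2 := by exact_mod_cast e3
    have e5 : ((2:ℝ) ^ (658 * g) * E ^ 80) ^ X = (D ^ (329 * g) * F ^ 10) ^ 2 := by
      rw [hD, hF, mul_pow, mul_pow]
      simp only [← pow_mul]
      congr 2 <;> ring
    rw [e5] at e4
    exact (pow_le_pow_iff_left₀ (by positivity) (by positivity) (by norm_num)).mp e4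
  have huR : (1:ℝ) ≤ u := by exact_mod_cast (by omega : 1 ≤ u)
  have hF1 : 1 ≤ F := one_le_pow₀ hE1R
  have hgD : (2:ℝ) ^ g ≤ D ^ g := pow_le_pow_left₀ (by norm_num) hD2 _
  have hu0 : 0 < (u:ℝ) ^ m := by positivity
  have hm3 : 1 ≤ 3 * (m : ℝ) := by linarith
  have hm6 : 1 ≤ 6 * (m : ℝ) := by linarith
  refine baker_core a b u v m (2 * X) 16 (16 * τ) S (2 ^ g) (4 ^ τ) θ (2 ^ g / (u:ℝ) ^ m) Q R E
    ((3 * (m : ℝ)) ^ (2 * X)) ((6 * (m : ℝ)) ^ (16 * X)) ha hb (by omega) hv (by exact_mod_cast haA) (by exact_mod_cast hbA)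
    ?_ ?_ huv (by omega) (by omega) hSm (by rw [hX]; ring) hθ hθm ?_ hε hQ ?_ hE1R ?_ (one_le_pow₀ hm3)
    ?_ (one_le_pow₀ hm6) ?_ ?_ ?_
  · have : 2 ^ τ ≤ 4 ^ τ := Nat.pow_le_pow_left (by norm_num) _
    exact_mod_cast (by omega : u ≤ 4 ^ τ)
  · have : 4 ^ τ = 2 ^ τ * 2 ^ τ := by rw [← mul_pow]; norm_num
    have h3 : 2 ^ 1 ≤ 2 ^ τ := Nat.pow_le_pow_right (by norm_num) (by omega)
    have : v ≤ 4 ^ τ := by nlinarith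
    exact_mod_cast this
  · rw [div_le_one hu0]
    refine le_trans ?_ hUU
    calc (2:ℝ) ^ g ≤ D ^ g := hgD
      _ ≤ D ^ (329 * g) := pow_le_pow_right₀ (by linarith) (by omega)
      _ ≤ D ^ (329 * g) * F ^ 10 := le_mul_of_one_le_right (by positivity) (one_le_pow₀ hF1)
  · rw [hR]; nlinarith
  · rw [hR, show (1 + 2 * (E:ℝ)) * Q - Q = E * (2 * Q) by ring]
    rw [div_le_div_iff₀ (by positivity) (by positivity)]
    linarith
  · intro k hk
    refine le_trans ?_ (pow_div_fact_le m (2 * X) k hmR hk.le)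
    gcongr
  · rw [show 16 * τ * S = 16 * X by rw [hX]; ring]
    have h1 := pow_div_fact_le m (16 * X) (16 * X - 1) hmR (by omega)
    have h2 : ((16 * X : ℕ) : ℝ) ≤ 2 ^ (16 * X) := by exact_mod_cast Nat.lt_two_pow_self.le
    have h3 : (4 * R) ^ (16 * X - 1) / ((16 * X - 1).factorial : ℝ) ≤ (3 * (m:ℝ)) ^ (16 * X) := by
      refine le_trans ?_ h1
      gcongr
    calc ((16 * X : ℕ) : ℝ) * ((4 * R) ^ (16 * X - 1) / ((16 * X - 1).factorial : ℝ))
        ≤ 2 ^ (16 * X) * (3 * (m:ℝ)) ^ (16 * X) := by gcongr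
      _ = _ := by rw [← mul_pow]; congr 1; ring
  · rw [show 16 * τ * S = 4 * X * 4 by rw [hX]; ring, pow_mul (E:ℝ)]
    exact combo1 D F _ _ _ _ _ _ _ hD2 hF92 (by positivity) (by positivity) (by positivity) (by positivity)
      (by positivity) (by positivity) (by positivity) hA1 hV1 hN hβF hA2 hV2 he
  · exact combo2 g hg D F _ _ _ _ _ _ _ _ _ _ _ hD2 (by positivity) (by positivity) (by positivity) (by positivity) (by positivity)
      (by positivity) (by positivity) (by positivity) (by positivity) (by positivity) (by positivity) hu0 hgD hA1 hV1 hN hβF hA2 hV2 hA3 hq hBF hUU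

lemma exp_beats (g : ℕ) : ∃ E0 : ℕ, ∀ E ≥ E0, (2 ^ (658 * g) * E ^ 80) ^ (2304 * g) ≤ 2 ^ E := by
  have h := tendsto_pow_const_div_const_pow_of_one_lt (80 * (2304 * g)) (one_lt_two : (1:ℝ) < 2)
  have hpos : (0:ℝ) < 1 / (2 ^ (658 * g)) ^ (2304 * g) := by positivity
  have h2 := (h.eventually (gt_mem_nhds hpos))
  rw [Filter.eventually_atTop] at h2
  obtain ⟨E0, hE0⟩ := h2
  refine ⟨E0, fun E hE => ?_⟩
  have h3 := hE0 E hE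
  rw [div_lt_div_iff₀ (by positivity) (by positivity), one_mul] at h3
  have h4 : (2 ^ (658 * g) * (E:ℝ) ^ 80) ^ (2304 * g) ≤ 2 ^ E := by
    rw [mul_pow, ← pow_mul (E:ℝ), mul_comm]
    exact h3.le
  exact_mod_cast h4

lemma part1 (a b : ℕ) (c : ℤ) (ha : 1 ≤ a) (hb : 1 ≤ b) (hc : c ≠ 0) :
    ∃ M0 : ℕ, ∀ m ≥ M0, ∀ u v : ℕ, 2 ≤ u → 1 ≤ v → (a : ℤ) * v ^ m - b * u ^ m ≠ c := by
  obtain ⟨g, hg⟩ : ∃ g, g = a + b + c.natAbs + 1 := ⟨_, rfl⟩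
  obtain ⟨E0, hE0⟩ := exp_beats g
  have hlt : g < 2 ^ g := Nat.lt_two_pow_self
  obtain ⟨E1, hE1⟩ : ∃ E1, E1 = E0 + 2 ^ 23 + 2304 * g := ⟨_, rfl⟩
  refine ⟨E1 * E1, fun m hm u v hu hv heq => ?_⟩
  have hEm : E1 ≤ Nat.sqrt m := Nat.le_sqrt.mpr hm
  have hs1 := Nat.sqrt_le m
  have hs2 := Nat.lt_succ_sqrt m
  obtain ⟨E, hE⟩ : ∃ E, E = Nat.sqrt m := ⟨_, rfl⟩
  rw [← hE] at hs1 hs2 hEm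
  have hE1le : 1 ≤ E := by omega
  have hEEm : E ≤ m := le_trans (Nat.le_mul_self E) hs1
  have hgm : g + 2 ≤ m := by omega
  have hum : 2 ^ m ≤ u ^ m := Nat.pow_le_pow_left hu m
  have h2gm : 2 ^ (g + 2) ≤ 2 ^ m := Nat.pow_le_pow_right (by norm_num) hgm
  have hum1 : 1 ≤ u ^ m := Nat.one_le_pow _ _ (by omega)
  have habs : |(a : ℤ) * v ^ m - b * u ^ m| ≤ 2 ^ g := by
    rw [heq, Int.abs_eq_natAbs]
    exact_mod_cast (by omega : c.natAbs ≤ 2 ^ g)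
  refine baker_fixed g a b u v m E (Nat.log 2 u + 1) (by omega) ha hb (by omega) (by omega) hu hv ?_ hs1 ?_ (by omega) (by omega)
    (hE0 E (by omega)) (Nat.lt_pow_succ_log_self (by norm_num) u) ?_ ?_ (by exact_mod_cast habs)
  · rintro rfl
    have h1 : ((u : ℤ) ^ m) ∣ c := ⟨(a : ℤ) - b, by rw [← heq]; ring⟩
    have h2 := Int.natAbs_dvd_natAbs.mpr h1
    rw [Int.natAbs_pow, Int.natAbs_natCast] at h2
    have h3 := Nat.le_of_dvd (by omega) h2
    rw [pow_add] at h2gm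
    omega
  · have : E.succ * E.succ ≤ 4 * (E * E) := by
      rw [Nat.succ_eq_add_one]; nlinarith
    omega
  · rw [pow_succ, mul_comm]
    exact Nat.mul_le_mul_left _ (Nat.pow_log_le_self 2 (by omega))
  · by_contra hcon
    push Not at hcon
    have h1 : (2 * u) ^ m ≤ v ^ m := Nat.pow_le_pow_left hcon.le m
    rw [mul_pow] at h1
    have h2 : (a : ℤ) * v ^ m ≤ b * u ^ m + 2 ^ g := by
      have := (abs_le.mp habs).2
      linarith
    have h3 : a * v ^ m ≤ b * u ^ m + 2 ^ g := by exact_mod_cast h2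
    have h4 : v ^ m ≤ a * v ^ m := Nat.le_mul_of_pos_left _ ha
    have h5 : b * u ^ m ≤ 2 ^ g * u ^ m := Nat.mul_le_mul_right _ (by omega)
    have h6 : 2 ^ g ≤ 2 ^ g * u ^ m := Nat.le_mul_of_pos_right _ hum1
    have h7 : 2 ^ (g + 2) * u ^ m ≤ 2 ^ m * u ^ m := Nat.mul_le_mul_right _ h2gm
    have h8 : 2 ^ (g + 2) * u ^ m = 4 * (2 ^ g * u ^ m) := by rw [pow_add]; ring
    have h9 : 1 ≤ 2 ^ g * u ^ m := Nat.mul_pos (by positivity) hum1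
    omega

lemma ap_dvd (m x L : ℕ) : L.factorial ∣ m ^ L * ∏ t ∈ range L, (x + m * t) := by
  rw [Nat.dvd_iff_prime_pow_dvd_dvd]
  intro p k hp hpk
  by_cases hpm : p ∣ m
  · have hk : k ≤ L := by
      have := Fact.mk hp
      have h1 : k ≤ padicValNat p L.factorial :=
        (padicValNat_dvd_iff_le L.factorial_ne_zero).mp hpk
      have h2 := sub_one_mul_padicValNat_factorial (p := p) L
      have h3 : 1 ≤ p - 1 := by have := hp.two_le; omega
      have h4 : padicValNat p L.factorial ≤ (p - 1) * padicValNat p L.factorial := Nat.le_mul_of_pos_left _ h3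
      omega
    exact Dvd.dvd.mul_right ((pow_dvd_pow p hk).trans (pow_dvd_pow_of_dvd hpm L)) _
  · apply Dvd.dvd.mul_left
    have hcop : Nat.Coprime m (p ^ k) := (Nat.Coprime.pow_left k ((Nat.Prime.coprime_iff_not_dvd hp).mpr hpm)).symm
    have : NeZero (p ^ k) := ⟨pow_ne_zero _ hp.ne_zero⟩
    rw [← ZMod.natCast_eq_zero_iff]
    let U := ZMod.unitOfCoprime m hcop
    have hU : (U : ZMod (p ^ k)) = m := ZMod.coe_unitOfCoprime m hcop
    let y : ℕ := ((x : ZMod (p ^ k)) * (U⁻¹ : (ZMod (p ^ k))ˣ)).val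
    have hy : (m : ZMod (p ^ k)) * (y : ZMod (p ^ k)) = x := by
      simp only [y]
      rw [ZMod.natCast_val, ZMod.cast_id', id, ← hU, mul_left_comm, Units.mul_inv, mul_one]
    have h1 : p ^ k ∣ ∏ t ∈ range L, (y + t) := by
      rw [← Nat.ascFactorial_eq_prod_range]
      exact hpk.trans (Nat.factorial_dvd_ascFactorial y L)
    have h2 : ((∏ t ∈ range L, (x + m * t) : ℕ) : ZMod (p ^ k)) = m ^ L * ((∏ t ∈ range L, (y + t) : ℕ) : ZMod (p ^ k)) := by
      push_cast
      rw [← hy]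
      simp_rw [← mul_add]
      rw [prod_mul_distrib]
      simp
    rw [h2, (ZMod.natCast_eq_zero_iff _ _).mpr h1, mul_zero]

/-- products of progressions -/
def fM (m n : ℕ) : ℕ := ∏ k ∈ range n, (m * (k + 1) - 1)
/-- products of progressions -/
def fP (m n : ℕ) : ℕ := ∏ k ∈ range n, (m * k + 1)

lemma fM_split (m i n : ℕ) (hm : 1 ≤ m) : ∃ X, fM m (i + n) = fM m i * X ∧ n.factorial ∣ m ^ n * X := by
  refine ⟨∏ t ∈ range n, (m * (i + t + 1) - 1), ?_, ?_⟩
  · rw [fM, prod_range_add]; rfl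
  · have h := ap_dvd m (m * (i + 1) - 1) n
    have h2 : ∏ t ∈ range n, (m * (i + 1) - 1 + m * t) = ∏ t ∈ range n, (m * (i + t + 1) - 1) := by
      refine prod_congr rfl fun t _ => ?_
      have : 1 ≤ m * (i + 1) := Nat.mul_pos hm (by omega)
      have e : m * (i + t + 1) = m * (i + 1) + m * t := by ring
      omega
    rwa [h2] at h

lemma fP_split (m i n : ℕ) : ∃ X, fP m (i + n) = fP m i * X ∧ n.factorial ∣ m ^ n * X := by
  refine ⟨∏ t ∈ range n, (m * (i + t) + 1), ?_, ?_⟩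
  · rw [fP, prod_range_add]; rfl
  · have h := ap_dvd m (m * i + 1) n
    have h2 : ∏ t ∈ range n, (m * i + 1 + m * t) = ∏ t ∈ range n, (m * (i + t) + 1) := by
      refine prod_congr rfl fun t _ => by ring
    rwa [h2] at h

/-- common denominator -/
def DD (m M : ℕ) : ℕ := m ^ (2 * M + 2) * (fM m M * fP m (M + 1))

/-- key divisibility -/
lemma key_dvd (m M i n j l e x y : ℕ) (hm : 1 ≤ m) (hi : i + n ≤ M) (hj : j + l ≤ M + 1) (he : e + n + l ≤ 2 * M + 2)
    (hx : x ≤ n) (hy : y ≤ l) :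
    m ^ e * (x.factorial * y.factorial) * (fM m i * fP m j) ∣ DD m M := by
  obtain ⟨X, hX, hXd⟩ := fM_split m i n hm
  obtain ⟨Y, hY, hYd⟩ := fP_split m j l
  obtain ⟨X', hX', -⟩ := fM_split m (i + n) (M - (i + n)) hm
  obtain ⟨Y', hY', -⟩ := fP_split m (j + l) (M + 1 - (j + l))
  have e1 : i + n + (M - (i + n)) = M := by omega
  have e2 : j + l + (M + 1 - (j + l)) = M + 1 := by omega
  rw [e1] at hX'
  rw [e2] at hY'
  have h1 : x.factorial ∣ m ^ n * X := (Nat.factorial_dvd_factorial hx).trans hXd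
  have h2 : y.factorial ∣ m ^ l * Y := (Nat.factorial_dvd_factorial hy).trans hYd
  have h3 : m ^ e * (x.factorial * y.factorial) * (fM m i * fP m j) ∣ m ^ e * ((m ^ n * X) * (m ^ l * Y)) * (fM m i * fP m j) :=
    mul_dvd_mul (mul_dvd_mul_left _ (mul_dvd_mul h1 h2)) dvd_rfl
  refine h3.trans ?_
  obtain ⟨d, hd⟩ := Nat.exists_eq_add_of_le he
  rw [DD, hX', hY', hX, hY, hd]
  refine ⟨m ^ d * X' * Y', ?_⟩
  rw [pow_add, pow_add, pow_add]; ring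

lemma prodA (m p i : ℕ) (hi : i < p) :
    ∏ i' ∈ (range p).erase i, (((m * i : ℕ) : ℤ) - ((m * i' : ℕ) : ℤ)).natAbs = m ^ (p - 1) * (i.factorial * (p - 1 - i).factorial) := by
  obtain ⟨r, rfl⟩ := Nat.exists_eq_add_of_lt hi
  have h1 : ∏ i' ∈ (range (i + r + 1)).erase i, (((m * i : ℕ) : ℤ) - ((m * i' : ℕ) : ℤ)).natAbs
      = ∏ i' ∈ (range (i + r + 1)).erase i, (if i' = i then 1 else (((m * i : ℕ) : ℤ) - ((m * i' : ℕ) : ℤ)).natAbs) := by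
    refine prod_congr rfl fun x hx => ?_
    rw [if_neg (ne_of_mem_erase hx)]
  rw [h1, prod_erase _ (by simp), show i + r + 1 = i + 1 + r by ring, prod_range_add, prod_range_succ, if_pos rfl, mul_one]
  have h2 : ∏ x ∈ range i, (if x = i then 1 else (((m * i : ℕ) : ℤ) - ((m * x : ℕ) : ℤ)).natAbs) = m ^ i * i.factorial := by
    rw [← prod_range_reflect, ← prod_range_add_one_eq_factorial]
    conv_rhs => rw [← card_range i, ← prod_const, card_range]
    rw [← prod_mul_distrib]
    refine prod_congr rfl fun x hx => ?_
    have := mem_range.mp hx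
    rw [if_neg (by omega)]
    obtain ⟨d, hd⟩ := Nat.exists_eq_add_of_lt this
    rw [hd, show x + d + 1 - 1 - x = d by omega]
    push_cast
    rw [show ((m : ℤ) * (x + d + 1) - m * d) = ((m * (x + 1) : ℕ) : ℤ) by push_cast; ring, Int.natAbs_natCast]
  have h3 : ∏ x ∈ range r, (if i + 1 + x = i then 1 else (((m * i : ℕ) : ℤ) - ((m * (i + 1 + x) : ℕ) : ℤ)).natAbs) = m ^ r * r.factorial := by
    rw [← prod_range_add_one_eq_factorial]
    conv_rhs => rw [← card_range r, ← prod_const, card_range]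
    rw [← prod_mul_distrib]
    refine prod_congr rfl fun x hx => ?_
    rw [if_neg (by omega)]
    push_cast
    rw [show ((m : ℤ) * i - m * (i + 1 + x)) = -((m * (x + 1) : ℕ) : ℤ) by push_cast; ring, Int.natAbs_neg, Int.natAbs_natCast]
  rw [h2, h3, show i + 1 + r - 1 = i + r by omega, show i + r - i = r by omega, pow_add]
  ring

lemma prodB1 (m q i : ℕ) (hm : 1 ≤ m) (hi : i ≤ q) :
    ∏ j ∈ range q, (((m * i : ℕ) : ℤ) - ((m * j + 1 : ℕ) : ℤ)).natAbs = fM m i * fP m (q - i) := by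
  obtain ⟨r, rfl⟩ := Nat.exists_eq_add_of_le hi
  rw [prod_range_add, show i + r - i = r by omega]
  congr 1
  · rw [← prod_range_reflect, fM]
    refine prod_congr rfl fun x hx => ?_
    have := mem_range.mp hx
    obtain ⟨d, hd⟩ := Nat.exists_eq_add_of_lt this
    rw [hd, show x + d + 1 - 1 - x = d by omega]
    have h1 : 1 ≤ m * (x + 1) := Nat.mul_pos hm (by omega)
    rw [show (((m * (x + d + 1) : ℕ) : ℤ) - ((m * d + 1 : ℕ) : ℤ)) = ((m * (x + 1) - 1 : ℕ) : ℤ) by push_cast [h1]; ring, Int.natAbs_natCast]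
  · rw [fP]
    refine prod_congr rfl fun x hx => ?_
    rw [show (((m * i : ℕ) : ℤ) - ((m * (i + x) + 1 : ℕ) : ℤ)) = -((m * x + 1 : ℕ) : ℤ) by push_cast; ring, Int.natAbs_neg, Int.natAbs_natCast]

lemma prodB2 (m p j : ℕ) (hm : 1 ≤ m) (hj : j ≤ p) :
    ∏ i ∈ range p, (((m * j + 1 : ℕ) : ℤ) - ((m * i : ℕ) : ℤ)).natAbs = fM m (p - 1 - j) * fP m (j + 1) := by
  have key : ∀ n : ℕ, n ≤ j + 1 → ∏ i ∈ range n, (((m * j + 1 : ℕ) : ℤ) - ((m * i : ℕ) : ℤ)).natAbs = ∏ i ∈ range n, (m * (j - i) + 1) := by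
    intro n hn
    refine prod_congr rfl fun x hx => ?_
    have := mem_range.mp hx
    obtain ⟨d, rfl⟩ := Nat.exists_eq_add_of_le (by omega : x ≤ j)
    rw [show x + d - x = d by omega]
    rw [show (((m * (x + d) + 1 : ℕ) : ℤ) - ((m * x : ℕ) : ℤ)) = ((m * d + 1 : ℕ) : ℤ) by push_cast; ring, Int.natAbs_natCast]
  have hP : ∏ i ∈ range (j + 1), (m * (j - i) + 1) = fP m (j + 1) := by
    rw [fP, ← prod_range_reflect]
    refine prod_congr rfl fun x hx => ?_
    have := mem_range.mp hx
    rw [show j + 1 - 1 - x = j - x by omega, show j - (j - x) = x by omega]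
  rcases Nat.lt_or_ge j p with h | h
  · obtain ⟨r, rfl⟩ := Nat.exists_eq_add_of_lt h
    rw [show j + r + 1 = j + 1 + r by ring, prod_range_add, key _ le_rfl, hP, mul_comm, show j + 1 + r - 1 - j = r by omega]
    congr 1
    rw [fM]
    refine prod_congr rfl fun x hx => ?_
    have h1 : 1 ≤ m * (x + 1) := Nat.mul_pos hm (by omega)
    rw [show (((m * j + 1 : ℕ) : ℤ) - ((m * (j + 1 + x) : ℕ) : ℤ)) = -((m * (x + 1) - 1 : ℕ) : ℤ) by push_cast [h1]; ring, Int.natAbs_neg, Int.natAbs_natCast]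
  · obtain rfl : j = p := by omega
    rw [key _ (by omega), show j - 1 - j = 0 by omega, ← hP, prod_range_succ]
    simp [fM]

/-- the nodes -/
def nodes (m p q : ℕ) : Finset ℕ := (range p).image (fun i => m * i) ∪ (range q).image (fun j => m * j + 1)

lemma mod_ne (m i j : ℕ) (hm : 2 ≤ m) : m * i ≠ m * j + 1 := by
  intro h
  have h1 : m ∣ m * j + 1 := ⟨i, h.symm⟩
  have h2 := (Nat.dvd_add_right (dvd_mul_right m j)).mp h1
  have := Nat.le_of_dvd one_pos h2
  omega

lemma nodes_sum {R : Type*} [AddCommMonoid R] (m p q : ℕ) (hm : 2 ≤ m) (f : ℕ → R) :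
    ∑ n ∈ nodes m p q, f n = ∑ i ∈ range p, f (m * i) + ∑ j ∈ range q, f (m * j + 1) := by
  rw [nodes, sum_union, sum_image, sum_image]
  · intro x _ y _ h
    have : m * x = m * y := by simpa using h
    exact Nat.eq_of_mul_eq_mul_left (by omega) this
  · intro x _ y _ h
    exact Nat.eq_of_mul_eq_mul_left (by omega) h
  · rw [disjoint_left]
    simp only [mem_image]
    rintro x ⟨i, _, rfl⟩ ⟨j, _, h⟩
    exact mod_ne m i j hm h.symm

lemma nodes_card (m p q : ℕ) (hm : 2 ≤ m) : (nodes m p q).card = p + q := by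
  rw [card_eq_sum_ones, nodes_sum m p q hm]; simp

lemma nodes_prod_erase (m p q : ℕ) (hm : 2 ≤ m) (n : ℕ) (f : ℕ → ℕ) :
    ∏ n' ∈ (nodes m p q).erase n, f n' = (∏ i ∈ range p, if m * i = n then 1 else f (m * i)) * (∏ j ∈ range q, if m * j + 1 = n then 1 else f (m * j + 1)) := by
  have h1 : ∏ n' ∈ (nodes m p q).erase n, f n' = ∏ n' ∈ (nodes m p q).erase n, if n' = n then 1 else f n' := by
    refine prod_congr rfl fun x hx => ?_
    rw [if_neg (ne_of_mem_erase hx)]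
  rw [h1, prod_erase _ (by simp)]
  exact nodes_sum (R := Additive ℕ) m p q hm (fun n' => Additive.ofMul (if n' = n then 1 else f n'))

lemma node_dvd (m p q M n : ℕ) (hm : 2 ≤ m) (hpq : (p = M + 1 ∧ q = M) ∨ (p = M ∧ q = M + 1)) (hn : n ∈ nodes m p q) :
    ∏ n' ∈ (nodes m p q).erase n, ((n : ℤ) - (n' : ℤ)).natAbs ∣ DD m M := by
  rw [nodes_prod_erase m p q hm]
  rw [nodes, mem_union, mem_image, mem_image] at hn
  rcases hn with ⟨i, hi, rfl⟩ | ⟨j, hj, rfl⟩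
  · rw [mem_range] at hi
    have e1 : (∏ i' ∈ range p, if m * i' = m * i then 1 else (((m * i : ℕ) : ℤ) - ((m * i' : ℕ) : ℤ)).natAbs) = m ^ (p - 1) * (i.factorial * (p - 1 - i).factorial) := by
      rw [← prodA m p i hi]
      rw [← prod_erase (range p) (a := i) (by simp)]
      refine prod_congr rfl fun x hx => ?_
      rw [if_neg]
      intro h
      exact ne_of_mem_erase hx (Nat.eq_of_mul_eq_mul_left (by omega) h)
    have e2 : (∏ j ∈ range q, if m * j + 1 = m * i then 1 else (((m * i : ℕ) : ℤ) - ((m * j + 1 : ℕ) : ℤ)).natAbs) = fM m i * fP m (q - i) := by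
      rw [← prodB1 m q i (by omega) (by omega)]
      refine prod_congr rfl fun x hx => ?_
      rw [if_neg (mod_ne m i x hm).symm]
    rw [e1, e2, mul_comm i.factorial]
    exact key_dvd m M i (M - i) (q - i) (M + 1 - (q - i)) (p - 1) (p - 1 - i) i (by omega) (by omega) (by omega) (by omega) (by omega) (by omega)
  · rw [mem_range] at hj
    have e1 : (∏ j' ∈ range q, if m * j' + 1 = m * j + 1 then 1 else (((m * j + 1 : ℕ) : ℤ) - ((m * j' + 1 : ℕ) : ℤ)).natAbs) = m ^ (q - 1) * (j.factorial * (q - 1 - j).factorial) := by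
      rw [← prodA m q j hj]
      rw [← prod_erase (range q) (a := j) (by simp)]
      refine prod_congr rfl fun x hx => ?_
      rw [if_neg]
      · push_cast; congr 1; ring
      intro h
      exact ne_of_mem_erase hx (Nat.eq_of_mul_eq_mul_left (by omega) (Nat.succ.inj h))
    have e2 : (∏ i ∈ range p, if m * i = m * j + 1 then 1 else (((m * j + 1 : ℕ) : ℤ) - ((m * i : ℕ) : ℤ)).natAbs) = fM m (p - 1 - j) * fP m (j + 1) := by
      rw [← prodB2 m p j (by omega) (by omega)]
      refine prod_congr rfl fun x hx => ?_
      rw [if_neg (mod_ne m x j hm)]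
    rw [e1, e2, mul_comm]
    exact key_dvd m M (p - 1 - j) (M - (p - 1 - j)) (j + 1) (M - j) (q - 1) j (q - 1 - j) (by omega) (by omega) (by omega) (by omega) (by omega) (by omega)

lemma DD_le (m M : ℕ) (hm : 2 ≤ m) (hM : 1 ≤ M) : DD m M ≤ (m ^ 6) ^ M * (2 * M).factorial := by
  have h1 : fM m M * fP m (M + 1) ≤ m ^ (2 * M) * (M.factorial * M.factorial) := by
    rw [fM, fP, prod_range_succ']
    simp only [mul_zero, zero_add, mul_one]
    rw [← prod_mul_distrib, ← prod_range_add_one_eq_factorial, ← prod_mul_distrib, pow_mul]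
    conv_rhs => rw [← card_range M, ← prod_const, card_range]
    rw [← prod_mul_distrib]
    apply prod_le_prod'
    intro k _
    obtain ⟨d, hd⟩ : ∃ d, m * (k + 1) = d + 1 := Nat.exists_eq_succ_of_ne_zero (by positivity)
    have e : m ^ 2 * ((k + 1) * (k + 1)) = (m * (k + 1)) * (m * (k + 1)) := by ring
    rw [e, hd, Nat.add_sub_cancel]
    nlinarith
  have h2 : M.factorial * M.factorial ≤ (2 * M).factorial := by
    rw [two_mul]
    exact Nat.le_of_dvd (Nat.factorial_pos _) (Nat.factorial_mul_factorial_dvd_factorial_add M M)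
  rw [DD]
  calc m ^ (2 * M + 2) * (fM m M * fP m (M + 1)) ≤ m ^ (2 * M + 2) * (m ^ (2 * M) * (2 * M).factorial) := by
        exact Nat.mul_le_mul_left _ (h1.trans (Nat.mul_le_mul_left _ h2))
    _ = m ^ (2 * M + 2 + 2 * M) * (2 * M).factorial := by rw [pow_add m (2 * M + 2)]; ring
    _ ≤ m ^ (6 * M) * (2 * M).factorial := by
        gcongr
        · omega
        · omega
    _ = _ := by rw [pow_mul]

lemma DD_pos (m M : ℕ) (hm : 2 ≤ m) : 0 < DD m M := by
  rw [DD, fM, fP]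
  refine Nat.mul_pos (by positivity) (Nat.mul_pos (prod_pos fun k _ => ?_) (prod_pos fun k _ => by omega))
  have : 2 * 1 ≤ m * (k + 1) := Nat.mul_le_mul hm (by omega)
  omega

lemma weights_exist (m M p q : ℕ) (hm : 2 ≤ m) (hM : 1 ≤ M)
    (hpq : (p = M + 1 ∧ q = M) ∨ (p = M ∧ q = M + 1)) :
    ∃ w : ℕ → ℤ, (∀ n ∈ nodes m p q, w n ≠ 0) ∧ (∀ n ∈ nodes m p q, |(w n : ℝ)| ≤ ((4 * m ^ 6 : ℕ) : ℝ) ^ M) ∧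
      ∀ k < 2 * M, ∑ n ∈ nodes m p q, w n * (n.choose k : ℤ) = 0 := by
  have hcard : (nodes m p q).card = 2 * M + 1 := by rw [nodes_card m p q hm]; omega
  have hdvd : ∀ n ∈ nodes m p q, ∏ n' ∈ (nodes m p q).erase n, ((n : ℤ) - (n' : ℤ)) ∣ (DD m M : ℤ) := by
    intro n hn
    rw [← Int.natAbs_dvd_natAbs, Int.natAbs_natCast, ← Int.natAbsHom_apply, map_prod]
    exact node_dvd m p q M n hm hpq hn
  have hD0 := DD_pos m M hm
  let w : ℕ → ℤ := fun n => (DD m M : ℤ) / ∏ n' ∈ (nodes m p q).erase n, ((n : ℤ) - (n' : ℤ))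
  have hw : ∀ n ∈ nodes m p q, (∏ n' ∈ (nodes m p q).erase n, ((n : ℤ) - (n' : ℤ))) * w n = (DD m M : ℤ) :=
    fun n hn => Int.mul_ediv_cancel' (hdvd n hn)
  have hprod0 : ∀ n ∈ nodes m p q, (∏ n' ∈ (nodes m p q).erase n, ((n : ℤ) - (n' : ℤ))) ≠ 0 := by
    intro n hn h
    have := hw n hn
    rw [h, zero_mul] at this
    omega
  refine ⟨w, ?_, ?_, ?_⟩
  · intro n hn h
    have := hw n hn
    rw [h, mul_zero] at this
    omega
  · intro n hn
    have h1 := fact_le_prod_abs (nodes m p q) n hn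
    rw [hcard, Nat.add_sub_cancel] at h1
    have h2 : (DD m M : ℝ) ≤ (m ^ 6) ^ M * ((2 * M).factorial : ℝ) := by exact_mod_cast DD_le m M hm hM
    have h3 : (∏ n' ∈ (nodes m p q).erase n, |(n : ℝ) - n'|) * |(w n : ℝ)| = DD m M := by
      have := congrArg (fun x : ℤ => |(x : ℝ)|) (hw n hn)
      simp only [Int.cast_mul, abs_mul, Int.cast_prod, abs_prod, Int.cast_sub, Int.cast_natCast, Nat.abs_cast] at this
      exact this
    set Pr := ∏ n' ∈ (nodes m p q).erase n, |(n : ℝ) - n'| with hPr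
    have hfact : (0:ℝ) < (2 * M).factorial := by exact_mod_cast Nat.factorial_pos _
    have hPr0 : 0 < Pr := by
      by_contra hcon
      have : 2 ^ (2 * M) * Pr ≤ 0 := mul_nonpos_of_nonneg_of_nonpos (by positivity) (by linarith)
      linarith
    have h4 : Pr * |(w n : ℝ)| ≤ Pr * ((4 * m ^ 6 : ℕ) : ℝ) ^ M := by
      rw [h3]
      refine h2.trans ?_
      calc ((m:ℝ) ^ 6) ^ M * ((2 * M).factorial : ℝ) ≤ (m ^ 6) ^ M * (2 ^ (2 * M) * Pr) := by gcongr
        _ = Pr * ((4 * m ^ 6 : ℕ) : ℝ) ^ M := by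
          push_cast
          rw [mul_pow, pow_mul]; norm_num; ring
    exact le_of_mul_le_mul_left h4 hPr0
  · intro k hk
    have hinj : Set.InjOn (fun n : ℕ => (n : ℚ)) (nodes m p q : Finset ℕ) := fun a _ b _ h => Nat.cast_injective h
    have hdeg : (binP ℚ k).natDegree ≤ k := by
      refine (natDegree_C_mul_le _ _).trans ?_
      rw [descPochhammer_natDegree]
    have hdeg' : (binP ℚ k).degree < (nodes m p q).card := by
      refine lt_of_le_of_lt degree_le_natDegree ?_
      rw [hcard]
      exact_mod_cast (by omega : (binP ℚ k).natDegree < 2 * M + 1)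
    have h1 := Lagrange.coeff_eq_sum hinj hdeg'
    rw [hcard, Nat.add_sub_cancel, coeff_eq_zero_of_natDegree_lt (by omega)] at h1
    have h2 : ((∑ n ∈ nodes m p q, w n * (n.choose k : ℤ) : ℤ) : ℚ) = DD m M * ∑ i ∈ nodes m p q, eval (i:ℚ) (binP ℚ k) / ∏ j ∈ (nodes m p q).erase i, ((i:ℚ) - (j:ℚ)) := by
      push_cast
      rw [mul_sum]
      refine sum_congr rfl fun n hn => ?_
      rw [binP_eval]
      have e1 : (∏ n' ∈ (nodes m p q).erase n, ((n : ℚ) - (n' : ℚ))) * w n = DD m M := by exact_mod_cast hw n hn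
      have e2 : (∏ n' ∈ (nodes m p q).erase n, ((n : ℚ) - (n' : ℚ))) ≠ 0 := by exact_mod_cast hprod0 n hn
      rw [← e1]
      field_simp
    rw [← h1, mul_zero] at h2
    exact_mod_cast h2

lemma pade_exists (m M p q : ℕ) (hm : 2 ≤ m) (hM : 1 ≤ M)
    (hpq : (p = M + 1 ∧ q = M) ∨ (p = M ∧ q = M + 1)) :
    ∃ P Q : ℤ[X], P.natDegree ≤ p - 1 ∧ Q.natDegree ≤ q - 1 ∧ P.coeff (p - 1) ≠ 0 ∧ Q.coeff (q - 1) ≠ 0 ∧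
      (X - C 1) ^ (2 * M) ∣ P.comp (X ^ m) + X * Q.comp (X ^ m) ∧
      (∀ t : ℝ, |t - 1| ≤ 1 → |aeval (t ^ m) P + t * aeval (t ^ m) Q| ≤ |t - 1| ^ (2 * M) * ((32 * m ^ 6 * 2 ^ m : ℕ) : ℝ) ^ M) ∧
      (∀ z : ℝ, 0 ≤ z → z ≤ 2 → |aeval z Q| ≤ ((32 * m ^ 6 * 2 ^ m : ℕ) : ℝ) ^ M) := by
  obtain ⟨w, hw0, hwb, hws⟩ := weights_exist m M p q hm hM hpq
  have hp : 1 ≤ p := by omega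
  have hq : 1 ≤ q := by omega
  have hcard : (nodes m p q).card = 2 * M + 1 := by rw [nodes_card m p q hm]; omega
  have hmemA : ∀ i < p, m * i ∈ nodes m p q := fun i hi => by
    rw [nodes, mem_union]; exact Or.inl (mem_image.mpr ⟨i, mem_range.mpr hi, rfl⟩)
  have hmemB : ∀ i < q, m * i + 1 ∈ nodes m p q := fun i hi => by
    rw [nodes, mem_union]; exact Or.inr (mem_image.mpr ⟨i, mem_range.mpr hi, rfl⟩)
  have hnode_lt : ∀ n ∈ nodes m p q, n < m * M + 2 := by
    intro n hn
    rw [nodes, mem_union, mem_image, mem_image] at hn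
    rcases hn with ⟨i, hi, rfl⟩ | ⟨i, hi, rfl⟩ <;> rw [mem_range] at hi
    · have := Nat.mul_le_mul_left m (by omega : i ≤ M); omega
    · have := Nat.mul_le_mul_left m (by omega : i ≤ M); omega
  let P : ℤ[X] := ∑ i ∈ range p, C (w (m * i)) * X ^ i
  let Q : ℤ[X] := ∑ j ∈ range q, C (w (m * j + 1)) * X ^ j
  have hcoefP : ∀ i < p, P.coeff i = w (m * i) := by
    intro i hi
    simp [P, finsetSum_coeff, coeff_X_pow, hi]
  have hcoefQ : ∀ i < q, Q.coeff i = w (m * i + 1) := by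
    intro i hi
    simp [Q, finsetSum_coeff, coeff_X_pow, hi]
  have hG : P.comp (X ^ m) + X * Q.comp (X ^ m) = ∑ n ∈ nodes m p q, C (w n) * X ^ n := by
    rw [nodes_sum m p q hm]
    simp only [P, Q, Polynomial.sum_comp, mul_comp, C_comp, pow_comp, X_comp, mul_sum]
    refine congrArg₂ (fun A B : ℤ[X] => A + B) (sum_congr rfl fun i _ => ?_) (sum_congr rfl fun i _ => ?_)
    · rw [pow_mul]
    · rw [pow_succ, pow_mul]; ring
  have hGr : ∀ t : ℝ, aeval (t ^ m) P + t * aeval (t ^ m) Q = ∑ n ∈ nodes m p q, (w n : ℝ) * t ^ n := by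
    intro t
    have := congrArg (aeval t) hG
    simpa [aeval_comp] using this
  have h2m : (0:ℝ) < m := by exact_mod_cast (by omega : 0 < m)
  refine ⟨P, Q, ?_, ?_, ?_, ?_, ?_, ?_, ?_⟩
  · refine natDegree_sum_le_of_forall_le _ _ fun i hi => ?_
    have := mem_range.mp hi
    exact (natDegree_C_mul_X_pow_le _ _).trans (by omega)
  · refine natDegree_sum_le_of_forall_le _ _ fun i hi => ?_
    have := mem_range.mp hi
    exact (natDegree_C_mul_X_pow_le _ _).trans (by omega)
  · rw [hcoefP _ (by omega)]; exact hw0 _ (hmemA _ (by omega))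
  · rw [hcoefQ _ (by omega)]; exact hw0 _ (hmemB _ (by omega))
  · rw [hG, X_sub_C_pow_dvd_iff, X_pow_dvd_iff]
    intro d hd
    rw [← hws d hd, Polynomial.sum_comp, finsetSum_coeff]
    refine sum_congr rfl fun n _ => ?_
    simp only [mul_comp, C_comp, pow_comp, X_comp, coeff_C_mul, map_one, coeff_X_add_one_pow]
  · intro t ht
    rw [hGr]
    set δ := t - 1 with hδ
    have e1 : ∑ n ∈ nodes m p q, (w n : ℝ) * t ^ n = ∑ k ∈ range (m * M + 2), δ ^ k * ∑ n ∈ nodes m p q, (w n : ℝ) * (n.choose k : ℝ) := by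
      simp_rw [mul_sum]
      rw [sum_comm]
      refine sum_congr rfl fun n hn => ?_
      have e2 : t ^ n = ∑ k ∈ range (n + 1), δ ^ k * (n.choose k : ℝ) := by
        rw [show t = δ + 1 by rw [hδ]; ring, add_pow]
        simp
      have e3 : ∑ k ∈ range (n + 1), δ ^ k * (n.choose k : ℝ) = ∑ k ∈ range (m * M + 2), δ ^ k * (n.choose k : ℝ) := by
        refine sum_subset (range_subset_range.mpr (hnode_lt n hn)) fun k _ hk => ?_
        rw [mem_range, not_lt] at hk
        rw [Nat.choose_eq_zero_of_lt (by omega)]; simp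
      rw [e2, e3, mul_sum]
      exact sum_congr rfl fun k _ => by ring
    rw [e1]
    have hb1 : ∀ k ∈ range (m * M + 2), |δ ^ k * ∑ n ∈ nodes m p q, (w n : ℝ) * (n.choose k : ℝ)| ≤ |δ| ^ (2 * M) * ∑ n ∈ nodes m p q, ((4 * m ^ 6 : ℕ) : ℝ) ^ M * (n.choose k : ℝ) := by
      intro k _
      by_cases hk : k < 2 * M
      · have : ∑ n ∈ nodes m p q, (w n : ℝ) * (n.choose k : ℝ) = 0 := by exact_mod_cast hws k hk
        rw [this, mul_zero, abs_zero]; positivity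
      · rw [abs_mul, abs_pow]
        have h1 : |δ| ^ k ≤ |δ| ^ (2 * M) := pow_le_pow_of_le_one (abs_nonneg _) ht (by omega)
        have h2 : |∑ n ∈ nodes m p q, (w n : ℝ) * (n.choose k : ℝ)| ≤ ∑ n ∈ nodes m p q, ((4 * m ^ 6 : ℕ) : ℝ) ^ M * (n.choose k : ℝ) := by
          refine (abs_sum_le_sum_abs _ _).trans (sum_le_sum fun n hn => ?_)
          rw [abs_mul, Nat.abs_cast]
          exact mul_le_mul_of_nonneg_right (hwb n hn) (by positivity)
        exact mul_le_mul h1 h2 (abs_nonneg _) (by positivity)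
    refine (abs_sum_le_sum_abs _ _).trans ((sum_le_sum hb1).trans ?_)
    rw [← mul_sum]
    refine mul_le_mul_of_nonneg_left ?_ (by positivity)
    rw [sum_comm]
    have hb2 : ∀ n ∈ nodes m p q, ∑ k ∈ range (m * M + 2), ((4 * m ^ 6 : ℕ) : ℝ) ^ M * (n.choose k : ℝ) ≤ ((4 * m ^ 6 : ℕ) : ℝ) ^ M * 2 ^ (m * M + 1) := by
      intro n hn
      rw [← mul_sum]
      refine mul_le_mul_of_nonneg_left ?_ (by positivity)
      have e3 : ∑ k ∈ range (n + 1), (n.choose k : ℝ) = ∑ k ∈ range (m * M + 2), (n.choose k : ℝ) := by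
        refine sum_subset (range_subset_range.mpr (hnode_lt n hn)) fun k _ hk => ?_
        rw [mem_range, not_lt] at hk
        rw [Nat.choose_eq_zero_of_lt (by omega)]; simp
      have e4 : ∑ k ∈ range (n + 1), (n.choose k : ℝ) = 2 ^ n := by exact_mod_cast Nat.sum_range_choose n
      rw [← e3, e4]
      have := hnode_lt n hn
      exact pow_le_pow_right₀ (by norm_num) (by omega)
    refine (sum_le_sum hb2).trans ?_
    rw [sum_const, hcard, nsmul_eq_mul]
    have h8 : (2 * M + 1) * 2 ≤ 8 ^ M := by
      clear * - hM
      induction M, hM using Nat.le_induction with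
      | base => norm_num
      | succ k hk ih => rw [pow_succ]; omega
    have h8' : ((2 * M + 1 : ℕ) : ℝ) * 2 ≤ 8 ^ M := by exact_mod_cast h8
    calc ((2 * M + 1 : ℕ) : ℝ) * (((4 * m ^ 6 : ℕ) : ℝ) ^ M * 2 ^ (m * M + 1))
        = (((2 * M + 1 : ℕ) : ℝ) * 2) * (((4 * m ^ 6 : ℕ) : ℝ) ^ M * 2 ^ (m * M)) := by rw [pow_succ]; ring
      _ ≤ 8 ^ M * (((4 * m ^ 6 : ℕ) : ℝ) ^ M * 2 ^ (m * M)) := mul_le_mul_of_nonneg_right h8' (by positivity)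
      _ = _ := by
        rw [pow_mul, ← mul_pow, ← mul_pow]; congr 1; push_cast; ring
  · intro z hz0 hz2
    have e1 : aeval z Q = ∑ j ∈ range q, (w (m * j + 1) : ℝ) * z ^ j := by simp [Q]
    rw [e1]
    have hb : ∀ j ∈ range q, |(w (m * j + 1) : ℝ) * z ^ j| ≤ ((4 * m ^ 6 : ℕ) : ℝ) ^ M * 2 ^ M := by
      intro j hj
      have hj' := mem_range.mp hj
      rw [abs_mul, abs_pow, abs_of_nonneg hz0]
      refine mul_le_mul (hwb _ (hmemB j hj')) ?_ (by positivity) (by positivity)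
      exact (pow_le_pow_left₀ hz0 hz2 j).trans (pow_le_pow_right₀ (by norm_num) (by omega))
    refine (abs_sum_le_sum_abs _ _).trans ((sum_le_sum hb).trans ?_)
    rw [sum_const, card_range, nsmul_eq_mul]
    have hq4 : q ≤ 4 ^ M := by
      have : M + 1 ≤ 4 ^ M := by
        have := Nat.lt_pow_self (n := M) (by norm_num : 1 < 4); omega
      omega
    have hq4' : (q : ℝ) ≤ 4 ^ M := by exact_mod_cast hq4
    calc (q : ℝ) * (((4 * m ^ 6 : ℕ) : ℝ) ^ M * 2 ^ M) ≤ 4 ^ M * (((4 * m ^ 6 : ℕ) : ℝ) ^ M * 2 ^ M) :=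
          mul_le_mul_of_nonneg_right hq4' (by positivity)
      _ = ((32 * m ^ 6 : ℕ) : ℝ) ^ M := by
        rw [← mul_pow, ← mul_pow]; congr 1; push_cast; ring
      _ ≤ _ := by
        refine pow_le_pow_left₀ (by positivity) ?_ M
        exact_mod_cast Nat.le_mul_of_pos_right _ (by positivity)

lemma pade_det (m M : ℕ) (hm : 2 ≤ m) (P₀ Q₀ P₁ Q₁ : ℤ[X])
    (h1 : P₀.natDegree ≤ M) (h2 : Q₀.natDegree ≤ M - 1) (h3 : P₁.natDegree ≤ M - 1) (h4 : Q₁.natDegree ≤ M) (hM : 1 ≤ M)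
    (h5 : P₀.coeff M ≠ 0) (h6 : Q₁.coeff M ≠ 0)
    (hd0 : (X - C 1) ^ (2 * M) ∣ P₀.comp (X ^ m) + X * Q₀.comp (X ^ m))
    (hd1 : (X - C 1) ^ (2 * M) ∣ P₁.comp (X ^ m) + X * Q₁.comp (X ^ m)) (z : ℝ) (hz : z ≠ 1) :
    aeval z P₀ * aeval z Q₁ - aeval z P₁ * aeval z Q₀ ≠ 0 := by
  set D : ℤ[X] := P₀ * Q₁ - P₁ * Q₀ with hD
  have hcoef : D.coeff (M + M) ≠ 0 := by
    rw [hD, coeff_sub, coeff_mul_add_eq_of_natDegree_le h1 h4, coeff_eq_zero_of_natDegree_lt (p := P₁ * Q₀), sub_zero]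
    · exact mul_ne_zero h5 h6
    · refine lt_of_le_of_lt natDegree_mul_le ?_
      omega
  have hD0 : D ≠ 0 := fun h => hcoef (by rw [h, coeff_zero])
  have hdeg : D.natDegree ≤ 2 * M := by
    refine (natDegree_sub_le _ _).trans (max_le ?_ ?_)
    · exact natDegree_mul_le.trans (by omega)
    · exact natDegree_mul_le.trans (by omega)
  have hdiv : (X - C 1) ^ (2 * M) ∣ D.comp (X ^ m) := by
    have : D.comp (X ^ m) = (P₀.comp (X ^ m) + X * Q₀.comp (X ^ m)) * Q₁.comp (X ^ m) - (P₁.comp (X ^ m) + X * Q₁.comp (X ^ m)) * Q₀.comp (X ^ m) := by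
      rw [hD, sub_comp, mul_comp, mul_comp]; ring
    rw [this]
    exact dvd_sub (Dvd.dvd.mul_right hd0 _) (Dvd.dvd.mul_right hd1 _)
  obtain ⟨E, hE, hEn⟩ := exists_eq_pow_rootMultiplicity_mul_and_not_dvd D hD0 1
  set e := D.rootMultiplicity 1 with he
  have hE1 : E.eval 1 ≠ 0 := fun h => hEn (dvd_iff_isRoot.mpr h)
  have he2 : 2 * M ≤ e := by
    by_contra hlt
    push Not at hlt
    have hcomp : D.comp (X ^ m) = (X - C 1) ^ e * ((∑ i ∈ range m, X ^ i) ^ e * E.comp (X ^ m)) := by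
      conv_lhs => rw [hE]
      rw [mul_comp, pow_comp, sub_comp, X_comp, C_comp, ← mul_assoc, ← mul_pow]
      congr 2
      rw [map_one, mul_comm, geom_sum_mul]
    rw [hcomp, show 2 * M = e + (2 * M - e) by omega, pow_add] at hdiv
    have h7 := (mul_dvd_mul_iff_left (pow_ne_zero e (X_sub_C_ne_zero (1:ℤ)))).mp hdiv
    have h8 : (X - C 1 : ℤ[X]) ∣ (∑ i ∈ range m, X ^ i) ^ e * E.comp (X ^ m) :=
      (dvd_pow_self _ (by omega)).trans h7
    rw [dvd_iff_isRoot, IsRoot] at h8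
    simp only [eval_mul, eval_pow, eval_finsetSum, eval_X, one_pow, eval_comp, sum_const, card_range, nsmul_eq_mul, mul_one] at h8
    rcases mul_eq_zero.mp h8 with h9 | h9
    · have := eq_zero_of_pow_eq_zero h9
      simp at this
      omega
    · exact hE1 h9
  have hE0 : E ≠ 0 := fun h => by rw [h] at hE1; simp at hE1
  have hdegE : e + E.natDegree = D.natDegree := by
    conv_rhs => rw [hE]
    rw [natDegree_mul (pow_ne_zero _ (X_sub_C_ne_zero _)) hE0, natDegree_pow, natDegree_X_sub_C, mul_one]
  have hEc : E = C (E.coeff 0) := eq_C_of_natDegree_eq_zero (by omega)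
  have hfin : aeval z P₀ * aeval z Q₁ - aeval z P₁ * aeval z Q₀ = (z - 1) ^ e * (E.coeff 0 : ℝ) := by
    have h10 := congrArg (aeval z) hE
    rw [hD, hEc] at h10
    simpa using h10
  rw [hfin]
  refine mul_ne_zero (pow_ne_zero _ (sub_ne_zero.mpr hz)) ?_
  have : E.coeff 0 ≠ 0 := fun h => hE0 (by rw [hEc, h, map_zero])
  exact_mod_cast this

lemma int_homog (P : ℤ[X]) (M : ℕ) (hP : P.natDegree ≤ M) (A B : ℤ) (hA : A ≠ 0) :
    ∃ N : ℤ, (A : ℝ) ^ M * aeval ((B : ℝ) / A) P = N := by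
  refine ⟨∑ i ∈ range (M + 1), P.coeff i * (B ^ i * A ^ (M - i)), ?_⟩
  have hA' : (A : ℝ) ≠ 0 := by exact_mod_cast hA
  rw [aeval_eq_sum_range' (Nat.lt_succ_of_le hP)]
  push_cast
  rw [mul_sum]
  refine sum_congr rfl fun i hi => ?_
  have hi' : i ≤ M := Nat.lt_succ_iff.mp (mem_range.mp hi)
  obtain ⟨d, rfl⟩ := Nat.exists_eq_add_of_le hi'
  rw [Nat.add_sub_cancel_left, zsmul_eq_mul, div_pow, pow_add]
  field_simp

set_option maxHeartbeats 2000000 in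
lemma thue_two (m M a b u1 v1 u2 v2 : ℕ) (c : ℤ) (hm : 2 ≤ m) (hM : 1 ≤ M) (ha : 1 ≤ a) (hb : 1 ≤ b)
    (hc : c ≠ 0) (hu1 : 1 ≤ u1) (hv1 : 1 ≤ v1) (hu2 : 1 ≤ u2)
    (hs1 : (a : ℤ) * v1 ^ m - b * u1 ^ m = c) (hs2 : (a : ℤ) * v2 ^ m - b * u2 ^ m = c)
    (hcv : c.natAbs ≤ a * v1 ^ m) (C1 : ℕ) (hC1 : C1 = 2 * c.natAbs ^ 2 * a * (32 * m ^ 6 * 2 ^ m))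
    (hg1 : 4 * C1 ^ M * u2 * v1 ≤ v1 ^ (m * M)) (hg2 : 4 * C1 ^ M * v1 ^ (m * M + 1) ≤ u2 ^ (m - 1)) : False := by
  obtain ⟨P₀, Q₀, a1, a2, a3, a4, a5, a6, a7⟩ := pade_exists m M (M + 1) M hm hM (Or.inl ⟨rfl, rfl⟩)
  obtain ⟨P₁, Q₁, b1, b2, b3, b4, b5, b6, b7⟩ := pade_exists m M M (M + 1) hm hM (Or.inr ⟨rfl, rfl⟩)
  rw [Nat.add_sub_cancel] at a1 a3 b2 b4
  have haR : (1:ℝ) ≤ a := by exact_mod_cast ha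
  have hbR : (1:ℝ) ≤ b := by exact_mod_cast hb
  have hu1R : (1:ℝ) ≤ u1 := by exact_mod_cast hu1
  have hv1R : (1:ℝ) ≤ v1 := by exact_mod_cast hv1
  have hu2R : (1:ℝ) ≤ u2 := by exact_mod_cast hu2
  set c' : ℝ := (c.natAbs : ℝ) with hc'
  have hc'abs : |(c : ℝ)| = c' := by rw [hc', Nat.cast_natAbs, Int.cast_abs]
  have hc1 : 1 ≤ c' := by
    have : 1 ≤ c.natAbs := Int.natAbs_pos.mpr hc
    rw [hc']; exact_mod_cast this
  set A : ℝ := (a : ℝ) * v1 ^ m with hA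
  have hV : (0:ℝ) < (v1:ℝ) ^ m := by positivity
  have hA0 : 0 < A := by positivity
  have hcA : c' ≤ A := by rw [hc', hA]; exact_mod_cast hcv
  have hs1R : A - b * u1 ^ m = c := by rw [hA]; exact_mod_cast hs1
  have hs2R : (a : ℝ) * v2 ^ m - b * u2 ^ m = c := by exact_mod_cast hs2
  set z : ℝ := b * u1 ^ m / A with hz
  have hz0 : 0 < z := by positivity
  have hz1 : z - 1 = -c / A := by
    rw [hz, ← hs1R]; field_simp; ring
  have hz1abs : |z - 1| = c' / A := by
    rw [hz1, abs_div, abs_neg, hc'abs, abs_of_pos hA0]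
  have hcA1 : c' / A ≤ 1 := (div_le_one hA0).mpr hcA
  have hzne : z ≠ 1 := by
    intro h
    rw [h, sub_self, abs_zero] at hz1abs
    have : 0 < c' / A := by positivity
    linarith
  have hz2 : z ≤ 2 := by
    have := le_abs_self (z - 1); linarith
  set t : ℝ := z ^ ((m : ℝ)⁻¹) with ht
  have ht0 : 0 < t := Real.rpow_pos_of_pos hz0 _
  have htm : t ^ m = z := Real.rpow_inv_natCast_pow hz0.le (by omega)
  have ht1 : |t - 1| ≤ c' / A := by
    rw [← hz1abs, ← htm]; exact abs_sub_one_le_pow t ht0.le m (by omega)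
  have ht2 : t ≤ 2 := by
    have := le_abs_self (t - 1); linarith
  have hU2 : (0:ℝ) < (u2 : ℝ) ^ m := by positivity
  have hw : |(v2 : ℝ) * u1 - t * (u2 * v1)| ≤ 2 * c' * v1 / (u2:ℝ) ^ (m - 1) := by
    have h1 : |(v2 : ℝ) * u1 / (u2 * v1) / t - 1| ≤ c' / (u2:ℝ) ^ m := by
      refine (abs_sub_one_le_pow _ (by positivity) m (by omega)).trans ?_
      have e : ((v2 : ℝ) * u1 / (u2 * v1) / t) ^ m - 1 = c / (b * u2 ^ m) := by
        rw [div_pow, div_pow, mul_pow, mul_pow, htm, hz, hA, ← hs2R]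
        field_simp
      rw [e, abs_div, hc'abs, abs_of_pos (by positivity)]
      apply div_le_div_of_nonneg_left (by linarith) hU2
      nlinarith
    have e2 : (v2 : ℝ) * u1 - t * (u2 * v1) = (t * (u2 * v1)) * ((v2 : ℝ) * u1 / (u2 * v1) / t - 1) := by
      field_simp
    rw [e2, abs_mul, abs_of_pos (by positivity)]
    calc t * (u2 * v1) * |(v2 : ℝ) * u1 / (u2 * v1) / t - 1| ≤ 2 * (u2 * v1) * (c' / (u2:ℝ) ^ m) := by gcongr
      _ = 2 * c' * v1 / (u2:ℝ) ^ (m - 1) := by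
        obtain ⟨d, rfl⟩ := Nat.exists_eq_add_of_le hm
        rw [show 2 + d - 1 = d + 1 by omega, show 2 + d = (d + 1) + 1 by omega, pow_succ (u2:ℝ) (d + 1)]
        field_simp
  set CC : ℝ := ((32 * m ^ 6 * 2 ^ m : ℕ) : ℝ) with hCC
  have hCC0 : 0 < CC := by
    rw [hCC]; exact_mod_cast (by have : 0 < m := by omega
                                 positivity)
  have hC1R : (C1 : ℝ) = 2 * c' ^ 2 * a * CC := by rw [hC1, hc', hCC]; push_cast; ring
  have hg1R : 4 * (C1:ℝ) ^ M * u2 * v1 ≤ v1 ^ (m * M) := by exact_mod_cast hg1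
  have hg2R : 4 * (C1:ℝ) ^ M * v1 ^ (m * M + 1) ≤ u2 ^ (m - 1) := by exact_mod_cast hg2
  -- any Padé pair gives zero
  have main : ∀ P Q : ℤ[X], P.natDegree ≤ M → Q.natDegree ≤ M →
      (|aeval (t ^ m) P + t * aeval (t ^ m) Q| ≤ |t - 1| ^ (2 * M) * CC ^ M) → (|aeval z Q| ≤ CC ^ M) →
      u2 * v1 * aeval z P + v2 * u1 * aeval z Q = 0 := by
    intro P Q hP hQ hPQ hQb
    rw [htm] at hPQ
    obtain ⟨N1, hN1⟩ := int_homog P M hP ((a : ℤ) * v1 ^ m) ((b : ℤ) * u1 ^ m) (by positivity)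
    obtain ⟨N2, hN2⟩ := int_homog Q M hQ ((a : ℤ) * v1 ^ m) ((b : ℤ) * u1 ^ m) (by positivity)
    push_cast at hN1 hN2
    rw [← hA, ← hz] at hN1 hN2
    have hL : A ^ M * (u2 * v1 * aeval z P + v2 * u1 * aeval z Q) = ((u2 * v1 * N1 + v2 * u1 * N2 : ℤ) : ℝ) := by
      push_cast
      rw [← hN1, ← hN2]; ring
    have hbound : |A ^ M * (u2 * v1 * aeval z P + v2 * u1 * aeval z Q)| ≤ 1 / 2 := by
      have e : A ^ M * (u2 * v1 * aeval z P + v2 * u1 * aeval z Q) =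
          A ^ M * (u2 * v1) * (aeval z P + t * aeval z Q) + A ^ M * ((v2 : ℝ) * u1 - t * (u2 * v1)) * aeval z Q := by ring
      rw [e]
      refine (abs_add_le _ _).trans ?_
      have t1 : |A ^ M * (u2 * v1) * (aeval z P + t * aeval z Q)| ≤ 1 / 4 := by
        rw [abs_mul, abs_of_pos (by positivity)]
        calc A ^ M * (u2 * v1) * |aeval z P + t * aeval z Q| ≤ A ^ M * (u2 * v1) * ((c' / A) ^ (2 * M) * CC ^ M) := by
              refine mul_le_mul_of_nonneg_left (hPQ.trans ?_) (by positivity)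
              gcongr
          _ = (u2 * v1) * (A * (c' / A) ^ 2 * CC) ^ M := by rw [mul_pow, mul_pow, ← pow_mul]; ring
          _ = (u2 * v1) * ((c' ^ 2 * CC) / A) ^ M := by
              congr 2; field_simp
          _ ≤ (u2 * v1) * (C1 / (v1:ℝ) ^ m) ^ M := by
              gcongr
              · rw [hC1R]
                have h1 : 0 < c' ^ 2 * CC := by positivity
                have h2 : c' ^ 2 * CC * 1 ≤ c' ^ 2 * CC * (2 * a) := mul_le_mul_of_nonneg_left (by linarith) h1.le
                linarith
              · exact le_mul_of_one_le_left hV.le haR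
          _ = (u2 * v1) * C1 ^ M / v1 ^ (m * M) := by rw [div_pow, ← pow_mul]; ring
          _ ≤ 1 / 4 := by
              rw [div_le_iff₀ (by positivity)]; linarith
      have t2 : |A ^ M * ((v2 : ℝ) * u1 - t * (u2 * v1)) * aeval z Q| ≤ 1 / 4 := by
        rw [abs_mul, abs_mul, abs_of_pos (by positivity : 0 < A ^ M)]
        calc A ^ M * |(v2 : ℝ) * u1 - t * (u2 * v1)| * |aeval z Q| ≤ A ^ M * (2 * c' * v1 / (u2:ℝ) ^ (m - 1)) * CC ^ M := by gcongr
          _ = (2 * c') * (a * CC) ^ M * v1 ^ (m * M + 1) / (u2:ℝ) ^ (m - 1) := by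
              rw [hA, mul_pow, mul_pow, ← pow_mul, pow_succ]; ring
          _ ≤ (2 * c' ^ 2) ^ M * (a * CC) ^ M * v1 ^ (m * M + 1) / (u2:ℝ) ^ (m - 1) := by
              gcongr
              have h1 : 2 * c' ≤ 2 * c' ^ 2 := by nlinarith
              refine h1.trans (le_self_pow₀ (by nlinarith) (by omega))
          _ = C1 ^ M * v1 ^ (m * M + 1) / (u2:ℝ) ^ (m - 1) := by
              rw [hC1R, ← mul_pow]; congr 3; ring
          _ ≤ 1 / 4 := by
              rw [div_le_iff₀ (by positivity)]; linarith
      linarith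
    rw [hL] at hbound
    have hzero : (u2 * v1 * N1 + v2 * u1 * N2 : ℤ) = 0 := by
      rw [← Int.abs_lt_one_iff]
      have : |((u2 * v1 * N1 + v2 * u1 * N2 : ℤ) : ℝ)| < 1 := by linarith
      rw [← Int.cast_abs] at this
      exact_mod_cast this
    rw [hzero, Int.cast_zero] at hL
    rcases mul_eq_zero.mp hL with h | h
    · exact absurd h (by positivity)
    · exact h
  have ht1' : |t - 1| ≤ 1 := ht1.trans hcA1
  have z0 := main P₀ Q₀ a1 (by omega) (a6 t ht1') (a7 z hz0.le hz2)
  have z1 := main P₁ Q₁ (by omega) b2 (b6 t ht1') (b7 z hz0.le hz2)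
  apply pade_det m M hm P₀ Q₀ P₁ Q₁ a1 a2 b1 b2 hM a3 b4 a5 b5 z hzne
  have huv : (u2 : ℝ) * v1 ≠ 0 := by positivity
  have : (u2 * v1 : ℝ) * (aeval z P₀ * aeval z Q₁ - aeval z P₁ * aeval z Q₀) = 0 := by
    linear_combination (aeval z Q₁) * z0 - (aeval z Q₀) * z1
  exact (mul_eq_zero.mp this).resolve_left huv

lemma thue_gap (m C1 V U : ℕ) (hm : 3 ≤ m) (hC : 1 ≤ C1) (hV4 : 4 ≤ V) (hVC : C1 ^ 2 ≤ V) (hU : V ^ (7 * m) ≤ U) :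
    ∃ M, 1 ≤ M ∧ 4 * C1 ^ M * U * V ≤ V ^ (m * M) ∧ 4 * C1 ^ M * V ^ (m * M + 1) ≤ U ^ (m - 1) := by
  have hV0 : 0 < V := by omega
  have hU0 : 0 < U := lt_of_lt_of_le (by positivity) hU
  have hCV : C1 ≤ V := (Nat.le_self_pow (by norm_num) C1).trans hVC
  have hex : ∃ M, 4 * C1 ^ M * U * V ≤ V ^ (m * M) := by
    refine ⟨4 * U * V, ?_⟩
    set N := 4 * U * V with hN
    have h1 : N ≤ V ^ N := (Nat.lt_pow_self (by omega)).le
    calc 4 * C1 ^ N * U * V = C1 ^ N * N := by rw [hN]; ring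
      _ ≤ V ^ N * V ^ N := Nat.mul_le_mul (Nat.pow_le_pow_left hCV N) h1
      _ = V ^ (2 * N) := by rw [← pow_add]; congr 1; ring
      _ ≤ V ^ (m * N) := Nat.pow_le_pow_right hV0 (Nat.mul_le_mul_right _ (by omega))
  classical
  have hf := Nat.find_spec hex
  have hmin : ∀ y < Nat.find hex, ¬ _ := fun y hy => Nat.find_min hex hy
  set M := Nat.find hex with hM
  have hM8 : 8 ≤ M := by
    by_contra hlt
    have h1 : V ^ (m * M) ≤ U := (Nat.pow_le_pow_right hV0 (by
      rw [mul_comm]; exact Nat.mul_le_mul_right _ (by omega))).trans hU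
    have h2 : 1 ≤ C1 ^ M := Nat.one_le_pow _ _ hC
    have h3 : 1 * U * 1 ≤ C1 ^ M * U * V := Nat.mul_le_mul (Nat.mul_le_mul_right _ h2) hV0
    have h4 : 4 * C1 ^ M * U * V = 4 * (C1 ^ M * U * V) := by ring
    rw [h4] at hf
    generalize C1 ^ M * U * V = Y at *
    generalize V ^ (m * M) = W at *
    omega
  obtain ⟨x, hx⟩ : ∃ x, M = x + 1 := ⟨M - 1, by omega⟩
  have hx7 : 7 ≤ x := by omega
  have hnx := hmin x (by omega)
  rw [not_le] at hnx
  have h16 : 16 ≤ V ^ 2 := by nlinarith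
  have hCx : ∀ y, C1 ^ (2 * y) ≤ V ^ y := fun y => by rw [pow_mul]; exact Nat.pow_le_pow_left hVC y
  have hexp : (2 * m - 1) * x ≥ 2 * x + 2 * m + 13 := by
    obtain ⟨d, rfl⟩ := Nat.exists_eq_add_of_le hm
    rw [show 2 * (3 + d) - 1 = 5 + 2 * d by omega]
    nlinarith
  have hsq : V ^ (2 * x + 2 * m + 9) < U ^ 2 := by
    have h1 : V ^ (2 * (m * x)) < 16 * C1 ^ (2 * x) * U ^ 2 * V ^ 2 := by
      have := Nat.pow_lt_pow_left hnx (by norm_num : (2:ℕ) ≠ 0)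
      calc V ^ (2 * (m * x)) = (V ^ (m * x)) ^ 2 := by rw [← pow_mul]; congr 1; ring
        _ < _ := this
        _ = _ := by ring
    have h2 : 16 * C1 ^ (2 * x) * U ^ 2 * V ^ 2 ≤ V ^ 2 * V ^ x * U ^ 2 * V ^ 2 := by
      exact Nat.mul_le_mul_right _ (Nat.mul_le_mul_right _ (Nat.mul_le_mul h16 (hCx x)))
    have h3 : V ^ (2 * x + 2 * m + 9) * V ^ (x + 4) ≤ V ^ (2 * (m * x)) := by
      rw [← pow_add]
      apply Nat.pow_le_pow_right hV0
      have h5 : (2 * m - 1) * x + x = 2 * (m * x) := by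
        obtain ⟨d, rfl⟩ := Nat.exists_eq_add_of_le hm
        rw [show 2 * (3 + d) - 1 = 5 + 2 * d by omega]; ring
      omega
    have h4 : V ^ 2 * V ^ x * U ^ 2 * V ^ 2 = U ^ 2 * V ^ (x + 4) := by ring
    rw [h4] at h2
    exact lt_of_mul_lt_mul_right (lt_of_le_of_lt h3 (lt_of_lt_of_le h1 h2)) (Nat.zero_le _)
  have hle : 16 * C1 ^ (2 * x + 1) * V ^ (m + 2) ≤ U := by
    apply le_of_lt
    apply lt_of_pow_lt_pow_left₀ 2 (Nat.zero_le _)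
    refine lt_of_le_of_lt ?_ hsq
    calc (16 * C1 ^ (2 * x + 1) * V ^ (m + 2)) ^ 2 = 16 ^ 2 * C1 ^ (2 * (2 * x + 1)) * V ^ (2 * (m + 2)) := by
          rw [mul_pow, mul_pow, ← pow_mul, ← pow_mul]; congr 2 <;> ring
      _ ≤ (V ^ 2) ^ 2 * V ^ (2 * x + 1) * V ^ (2 * (m + 2)) := by
          exact Nat.mul_le_mul_right _ (Nat.mul_le_mul (Nat.pow_le_pow_left h16 2) (hCx _))
      _ = V ^ (2 * x + 2 * m + 9) := by rw [← pow_mul, ← pow_add, ← pow_add]; congr 1; ring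
  refine ⟨M, by omega, hf, ?_⟩
  rw [hx]
  calc 4 * C1 ^ (x + 1) * V ^ (m * (x + 1) + 1) = 4 * C1 ^ (x + 1) * V ^ (m + 1) * V ^ (m * x) := by
        rw [show m * (x + 1) + 1 = (m + 1) + m * x by ring, pow_add V (m + 1)]; ring
    _ ≤ 4 * C1 ^ (x + 1) * V ^ (m + 1) * (4 * C1 ^ x * U * V) := Nat.mul_le_mul_left _ hnx.le
    _ = (16 * C1 ^ (2 * x + 1) * V ^ (m + 2)) * U := by
        rw [show 2 * x + 1 = (x + 1) + x by ring, pow_add C1 (x + 1)]; ring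
    _ ≤ U * U := Nat.mul_le_mul_right _ hle
    _ = U ^ 2 := by ring
    _ ≤ U ^ (m - 1) := Nat.pow_le_pow_right hU0 (by omega)

lemma part2 (m a b : ℕ) (c : ℤ) (hm : 3 ≤ m) (ha : 1 ≤ a) (hb : 1 ≤ b) (hc : c ≠ 0) :
    ∃ Bd : ℕ, ∀ u v : ℕ, 1 ≤ u → 1 ≤ v → (a : ℤ) * v ^ m - b * u ^ m = c → u ≤ Bd := by
  by_contra hcon
  push Not at hcon
  set C1 := 2 * c.natAbs ^ 2 * a * (32 * m ^ 6 * 2 ^ m) with hC1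
  have hc1 : 1 ≤ c.natAbs := Int.natAbs_pos.mpr hc
  have hC1p : 1 ≤ C1 := by
    have : 0 < m := by omega
    have h : 0 < C1 := by rw [hC1]; positivity
    exact h
  clear_value C1
  set V0 := 4 + C1 ^ 2 + c.natAbs with hV0
  obtain ⟨u1, v1, hu1, hv1, hs1, hb1⟩ := hcon (a * V0 ^ m + c.natAbs)
  have hv1V : V0 < v1 := by
    by_contra hle
    have h1 : v1 ^ m ≤ V0 ^ m := Nat.pow_le_pow_left (by omega) m
    have h2 : a * v1 ^ m ≤ a * V0 ^ m := Nat.mul_le_mul_left _ h1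
    have h3 : u1 ≤ b * u1 ^ m := (Nat.le_self_pow (by omega) u1).trans (Nat.le_mul_of_pos_left _ hb)
    zify at h2 h3 hb1
    have h4 := abs_le.mp (le_refl |c|)
    linarith
  obtain ⟨u2, v2, hu2, hv2, hs2, hb2⟩ := hcon (v1 ^ (7 * m))
  have hv1C : C1 ^ 2 ≤ v1 := by omega
  have hv14 : 4 ≤ v1 := by omega
  obtain ⟨M, hM, hg1, hg2⟩ := thue_gap m C1 v1 u2 hm hC1p hv14 hv1C hb2.le
  refine thue_two m M a b u1 v1 u2 v2 c (by omega) hM ha hb hc hu1 hv1 hu2 hs1 hs2 ?_ C1 hC1 hg1 hg2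
  have h1 : c.natAbs ≤ v1 := by omega
  exact h1.trans ((Nat.le_self_pow (by omega) v1).trans (Nat.le_mul_of_pos_left _ ha))

lemma bdd_unif (Q : ℕ → ℕ → Prop) (h : ∀ i, ∃ B, ∀ x, Q i x → x ≤ B) (N : ℕ) :
    ∃ B, ∀ i ≤ N, ∀ x, Q i x → x ≤ B := by
  choose B hB using h
  refine ⟨∑ i ∈ range (N + 1), B i, fun i hi x hx => (hB i x hx).trans ?_⟩
  exact single_le_sum (f := B) (fun _ _ => Nat.zero_le _) (mem_range.mpr (by omega))

lemma both_parts (a b : ℕ) (c : ℤ) (ha : 1 ≤ a) (hb : 1 ≤ b) (hc : c ≠ 0) :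
    ∃ Bd : ℕ, ∀ w : ℕ, (∃ m u v : ℕ, 3 ≤ m ∧ 1 ≤ u ∧ 1 ≤ v ∧ (a : ℤ) * v ^ m - b * u ^ m = c ∧ w = b * u ^ m) → w ≤ Bd := by
  obtain ⟨M0, hM0⟩ := part1 a b c ha hb hc
  obtain ⟨B, hB⟩ := bdd_unif (fun m w => ∃ u v : ℕ, 3 ≤ m ∧ 1 ≤ u ∧ 1 ≤ v ∧ (a : ℤ) * v ^ m - b * u ^ m = c ∧ w = b * u ^ m) (by
    intro m
    by_cases hm : 3 ≤ m
    · obtain ⟨Bd, hBd⟩ := part2 m a b c hm ha hb hc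
      refine ⟨b * Bd ^ m, ?_⟩
      rintro w ⟨u, v, _, hu, hv, he, rfl⟩
      exact Nat.mul_le_mul_left _ (Nat.pow_le_pow_left (hBd u v hu hv he) m)
    · exact ⟨0, fun w ⟨u, v, h, _⟩ => absurd h hm⟩) M0
  refine ⟨B + b, ?_⟩
  rintro w ⟨m, u, v, hm, hu, hv, he, hw⟩
  by_cases hmM : m ≤ M0
  · have := hB m hmM w ⟨u, v, hm, hu, hv, he, hw⟩
    omega
  · have hu1 : u = 1 := by
      by_contra hne
      exact hM0 m (by omega) u v (by omega) hv he
    rw [hw, hu1]; simp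

def QQ (c1 d1 c2 d2 x : ℕ) : Prop :=
  1 ≤ c1 ∧ 1 ≤ d1 ∧ 1 ≤ c2 ∧ 1 ≤ d2 ∧ ∃ m u v x1 : ℕ, 3 ≤ m ∧ 1 ≤ u ∧ 1 ≤ v ∧ (x1 = x + 1 ∨ x = x1 + 1) ∧
    c1 * x = d1 * u ^ m ∧ c2 * x1 = d2 * v ^ m

lemma QQ_bdd (c1 d1 c2 d2 : ℕ) : ∃ B, ∀ x, QQ c1 d1 c2 d2 x → x ≤ B := by
  by_cases hpos : 1 ≤ c1 ∧ 1 ≤ d1 ∧ 1 ≤ c2 ∧ 1 ≤ d2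
  swap
  · exact ⟨0, fun x ⟨h1, h2, h3, h4, _⟩ => absurd ⟨h1, h2, h3, h4⟩ hpos⟩
  obtain ⟨h1, h2, h3, h4⟩ := hpos
  have hc : ((c1 * c2 : ℕ) : ℤ) ≠ 0 := by positivity
  have ha : 1 ≤ c1 * d2 := Nat.mul_pos h1 h4
  have hb : 1 ≤ c2 * d1 := Nat.mul_pos h3 h2
  obtain ⟨B1, hB1⟩ := both_parts (c1 * d2) (c2 * d1) ((c1 * c2 : ℕ) : ℤ) ha hb hc
  obtain ⟨B2, hB2⟩ := both_parts (c1 * d2) (c2 * d1) (-((c1 * c2 : ℕ) : ℤ)) ha hb (neg_ne_zero.mpr hc)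
  refine ⟨B1 + B2, ?_⟩
  rintro x ⟨_, _, _, _, m, u, v, x1, hm, hu, hv, hx, e1, e2⟩
  have hw : x ≤ c2 * d1 * u ^ m := by
    rw [mul_assoc, ← e1, ← mul_assoc]
    exact Nat.le_mul_of_pos_left _ (Nat.mul_pos h3 h1)
  zify at e1 e2
  rcases hx with hx | hx
  · have := hB1 _ ⟨m, u, v, hm, hu, hv, by
      rw [hx] at e2; push_cast at e2 ⊢; linear_combination (-(c1:ℤ)) * e2 + (c2:ℤ) * e1, rfl⟩
    omega
  · have := hB2 _ ⟨m, u, v, hm, hu, hv, by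
      rw [hx] at e1; push_cast at e1 ⊢; linear_combination (-(c1:ℤ)) * e2 + (c2:ℤ) * e1, rfl⟩
    omega

lemma QQ_unif (N : ℕ) : ∃ B, ∀ c1 ≤ N, ∀ d1 ≤ N, ∀ c2 ≤ N, ∀ d2 ≤ N, ∀ x, QQ c1 d1 c2 d2 x → x ≤ B := by
  obtain ⟨B, hB⟩ := bdd_unif (fun c1 x => ∃ d1 ≤ N, ∃ c2 ≤ N, ∃ d2 ≤ N, QQ c1 d1 c2 d2 x) (fun c1 => by
    obtain ⟨B, hB⟩ := bdd_unif (fun d1 x => ∃ c2 ≤ N, ∃ d2 ≤ N, QQ c1 d1 c2 d2 x) (fun d1 => by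
      obtain ⟨B, hB⟩ := bdd_unif (fun c2 x => ∃ d2 ≤ N, QQ c1 d1 c2 d2 x) (fun c2 => by
        obtain ⟨B, hB⟩ := bdd_unif (fun d2 x => QQ c1 d1 c2 d2 x) (fun d2 => QQ_bdd c1 d1 c2 d2) N
        exact ⟨B, fun x ⟨d2, h, hx⟩ => hB d2 h x hx⟩) N
      exact ⟨B, fun x ⟨c2, h, hx⟩ => hB c2 h x hx⟩) N
    exact ⟨B, fun x ⟨d1, h, hx⟩ => hB d1 h x hx⟩) N
  exact ⟨B, fun c1 h1 d1 h2 c2 h3 d2 h4 x hx => hB c1 h1 x ⟨d1, h2, c2, h3, d2, h4, hx⟩⟩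

lemma pow_cancel_prime (p s t A B : ℕ) (hp : p.Prime) (hA : ¬ p ∣ A) (hB : ¬ p ∣ B) (h : p ^ s * A = p ^ t * B) :
    s = t ∧ A = B := by
  have key : ∀ s t A B : ℕ, ¬ p ∣ A → p ^ s * A = p ^ t * B → t ≤ s := by
    intro s t A B hA h
    by_contra hlt
    push Not at hlt
    obtain ⟨d, rfl⟩ := Nat.exists_eq_add_of_lt hlt
    rw [pow_succ, pow_add, mul_assoc, mul_assoc] at h
    have h1 := Nat.eq_of_mul_eq_mul_left (pow_pos hp.pos s) h
    exact hA ⟨p ^ d * B, by rw [h1]; ring⟩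
  have hst : s = t := le_antisymm (key t s B A hB h.symm) (key s t A B hA h)
  subst hst
  exact ⟨rfl, Nat.eq_of_mul_eq_mul_left (pow_pos hp.pos s) h⟩

lemma almost_power (m : ℕ) (Y : ℕ) : ∀ x r : ℕ, 1 ≤ Y → x * r = Y ^ m →
    ∃ c d u : ℕ, c ∣ Nat.gcd x r ∧ d ∣ Nat.gcd x r ∧ 1 ≤ u ∧ c * x = d * u ^ m := by
  induction Y using Nat.strong_induction_on with
  | _ Y ih =>
  intro x r hY h
  have hYm : 0 < Y ^ m := pow_pos hY m
  have hx0 : x ≠ 0 := by rintro rfl; rw [zero_mul] at h; omega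
  have hr0 : r ≠ 0 := by rintro rfl; rw [mul_zero] at h; omega
  by_cases hg : Nat.gcd x r = 1
  · obtain ⟨u, hu⟩ := exists_eq_pow_of_mul_eq_pow (by rw [gcd_eq_nat_gcd, hg]; exact isUnit_one) h
    by_cases hu0 : u = 0
    · refine ⟨1, 1, 1, by simp, by simp, le_rfl, ?_⟩
      by_cases hm : m = 0
      · rw [hu, hm]; simp
      · rw [hu, hu0, zero_pow hm] at hx0; exact absurd rfl hx0
    · exact ⟨1, 1, u, by simp, by simp, by omega, by rw [hu]⟩
  · obtain ⟨p, hp, hpg⟩ := Nat.exists_prime_and_dvd hg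
    obtain ⟨e, x0, hx0', hxe⟩ := Nat.exists_eq_pow_mul_and_not_dvd hx0 p hp.ne_one
    obtain ⟨f, r0, hr0', hrf⟩ := Nat.exists_eq_pow_mul_and_not_dvd hr0 p hp.ne_one
    obtain ⟨g, Y0, hY0', hYg⟩ := Nat.exists_eq_pow_mul_and_not_dvd (by omega : Y ≠ 0) p hp.ne_one
    have hY0 : 1 ≤ Y0 := by
      rcases Nat.eq_zero_or_pos Y0 with h0 | h0
      · rw [h0] at hY0'; exact absurd (dvd_zero p) hY0'
      · exact h0
    have hpe : p ^ (e + f) * (x0 * r0) = p ^ (g * m) * Y0 ^ m := by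
      rw [pow_add, pow_mul, ← mul_pow, ← hYg, ← h, hxe, hrf]; ring
    obtain ⟨h1, h2⟩ := pow_cancel_prime p _ _ _ _ hp (fun hd => (hp.dvd_mul.mp hd).elim hx0' hr0')
      (fun hd => hY0' (hp.dvd_of_dvd_pow hd)) hpe
    have hepos : 0 < e := by
      rcases Nat.eq_zero_or_pos e with h0 | h0
      · rw [h0, pow_zero, one_mul] at hxe
        rw [← hxe] at hx0'
        exact absurd (hpg.trans (Nat.gcd_dvd_left x r)) hx0'
      · exact h0
    have hgpos : 0 < g := by
      rcases Nat.eq_zero_or_pos g with h0 | h0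
      · rw [h0] at h1; omega
      · exact h0
    have hlt : Y0 < Y := by
      rw [hYg]
      have : 2 ≤ p ^ g := hp.two_le.trans (Nat.le_self_pow (by omega) p)
      nlinarith
    obtain ⟨c, d, u, hc, hd, hu, hcd⟩ := ih Y0 hlt x0 r0 hY0 h2
    have hlift : ∀ k q, k ≤ e → k ≤ f → q ∣ Nat.gcd x0 r0 → q * p ^ k ∣ Nat.gcd x r := by
      intro k q hke hkf hq
      rw [hxe, hrf]
      apply Nat.dvd_gcd
      · rw [mul_comm]
        exact mul_dvd_mul (pow_dvd_pow p hke) (hq.trans (Nat.gcd_dvd_left _ _))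
      · rw [mul_comm]
        exact mul_dvd_mul (pow_dvd_pow p hkf) (hq.trans (Nat.gcd_dvd_right _ _))
    rcases le_or_gt e f with hef | hef
    · refine ⟨c, d * p ^ e, u, ?_, hlift e d le_rfl hef hd, hu, ?_⟩
      · have := hlift 0 c (by omega) (by omega) hc
        rwa [pow_zero, mul_one] at this
      · rw [hxe]; linear_combination (p ^ e) * hcd
    · refine ⟨c * p ^ f, d, p ^ g * u, hlift f c hef.le le_rfl hc, ?_, Nat.mul_pos (pow_pos hp.pos g) hu, ?_⟩
      · have := hlift 0 d (by omega) (by omega) hd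
        rwa [pow_zero, mul_one] at this
      · rw [hxe, mul_pow, ← pow_mul, ← h1, pow_add]
        linear_combination (p ^ e * p ^ f) * hcd

lemma almost_power_eval (g f : ℤ[X]) (r : ℤ) (hgf : g = (X - C r) * f) (hf : f.eval r ≠ 0) (m : ℕ) (x y : ℤ)
    (hy : y ≠ 0) (h : y ^ m = g.eval x) :
    ∃ c d u : ℕ, 1 ≤ c ∧ 1 ≤ d ∧ 1 ≤ u ∧ c ≤ (f.eval r).natAbs ∧ d ≤ (f.eval r).natAbs ∧
      c * (x - r).natAbs = d * u ^ m := by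
  have h1 : (x - r).natAbs * (f.eval x).natAbs = y.natAbs ^ m := by
    rw [← Int.natAbs_mul, ← Int.natAbs_pow, h, hgf, eval_mul, eval_sub, eval_X, eval_C]
  obtain ⟨c, d, u, hc, hd, hu, hcd⟩ := almost_power m y.natAbs _ _ (Int.natAbs_pos.mpr hy) h1
  have hdiv : Nat.gcd (x - r).natAbs (f.eval x).natAbs ∣ (f.eval r).natAbs := by
    rw [← Int.natCast_dvd]
    have e : f.eval r = f.eval x - (f.eval x - f.eval r) := by ring
    rw [e]
    apply dvd_sub
    · exact Int.natCast_dvd.mpr (Nat.gcd_dvd_right _ _)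
    · exact (Int.natCast_dvd.mpr (Nat.gcd_dvd_left _ _)).trans (sub_dvd_eval_sub x r f)
  have hpos : 0 < (f.eval r).natAbs := Int.natAbs_pos.mpr hf
  exact ⟨c, d, u, Nat.pos_of_dvd_of_pos (hc.trans hdiv) hpos, Nat.pos_of_dvd_of_pos (hd.trans hdiv) hpos, hu,
    Nat.le_of_dvd hpos (hc.trans hdiv), Nat.le_of_dvd hpos (hd.trans hdiv), hcd⟩

lemma pP_factor (a : ℕ) (ha : 1 ≤ a) :
    ∃ q : ℤ[X], pP a = X * (X + 1) * q ∧ 0 < q.eval 0 ∧ 0 < q.eval (-1) := by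
  refine ⟨∏ i ∈ range (a - 1), (X + C ((i : ℤ) + 2)), ?_, ?_, ?_⟩
  · obtain ⟨b, rfl⟩ := Nat.exists_eq_add_of_le' ha
    rw [pP, prod_range_succ', prod_range_succ', Nat.add_sub_cancel]
    have : ∀ i ∈ range b, (X + C (((i + 1 + 1 : ℕ) : ℤ)) : ℤ[X]) = X + C ((i : ℤ) + 2) := by
      intro i _; congr 2
    rw [prod_congr rfl this]
    simp
    ring
  · rw [eval_prod]
    refine prod_pos fun i _ => ?_
    rw [eval_add, eval_X, eval_C]; positivity
  · rw [eval_prod]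
    refine prod_pos fun i _ => ?_
    rw [eval_add, eval_X, eval_C]; omega

/-- Let `n ≥ 2` and `T = (a_1, …, a_k)` with `0 ≤ a_1 < a_2 < ⋯ < a_k < n`, and assume either
`a_1 ≥ 2`, or `k ≥ 3` with `a_1 = 1`, `a_2 = 3`, `a_3 ≥ 5`.  Then the set of triples
`{(m, x, y) : m ≥ 3, y ≠ 0, y^m = g_T(x)}` is finite. -/
theorem statement6 (n k : ℕ) (a : ℕ → ℕ) (hn : 2 ≤ n) (hk : 1 ≤ k)
    (hmono : ∀ i j, i < j → j < k → a i < a j)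
    (hlt : ∀ i, i < k → a i < n)
    (hcase : 2 ≤ a 0 ∨ (3 ≤ k ∧ a 0 = 1 ∧ a 1 = 3 ∧ 5 ≤ a 2))
    (g : Polynomial ℤ) (hg : g = pP n + ∑ i ∈ Finset.range k, pP (a i)) :
    Set.Finite {t : ℕ × ℤ × ℤ | 3 ≤ t.1 ∧ t.2.2 ≠ 0 ∧ t.2.2 ^ t.1 = g.eval t.2.1} := by
  have ha1 : ∀ i, i < k → 1 ≤ a i := by
    intro i hi
    rcases Nat.eq_zero_or_pos i with h | h
    · subst h; omega
    · have := hmono 0 i h hi; omega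
  obtain ⟨q, hq, hq0, hq1⟩ := pP_factor n (by omega)
  have hfac : ∀ i, ∃ q : ℤ[X], i < k → pP (a i) = X * (X + 1) * q ∧ 0 < q.eval 0 ∧ 0 < q.eval (-1) := by
    intro i
    by_cases hi : i < k
    · obtain ⟨q, hq⟩ := pP_factor (a i) (ha1 i hi)
      exact ⟨q, fun _ => hq⟩
    · exact ⟨0, fun h => absurd h hi⟩
  choose r hr using hfac
  set h : ℤ[X] := q + ∑ i ∈ range k, r i with hh
  have hgh : g = X * (X + 1) * h := by
    rw [hg, hq, hh, mul_add (X * (X + 1)) q, mul_sum]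
    congr 1
    exact sum_congr rfl fun i hi => (hr i (mem_range.mp hi)).1
  have hh0 : 0 < h.eval 0 := by
    rw [hh, eval_add, eval_finsetSum]
    exact add_pos_of_pos_of_nonneg hq0 (sum_nonneg fun i hi => (hr i (mem_range.mp hi)).2.1.le)
  have hh1 : 0 < h.eval (-1) := by
    rw [hh, eval_add, eval_finsetSum]
    exact add_pos_of_pos_of_nonneg hq1 (sum_nonneg fun i hi => (hr i (mem_range.mp hi)).2.2.le)
  clear_value h
  have hev : ∀ x, g.eval x = x * (x + 1) * h.eval x := by
    intro x; rw [hgh]; simp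
  have f0 : ((X + 1) * h).eval 0 ≠ 0 := by simp; exact hh0.ne'
  have f1 : (X * h).eval (-1) ≠ 0 := by simp; exact hh1.ne'
  obtain ⟨B, hB⟩ := QQ_unif ((((X + 1) * h).eval 0).natAbs + ((X * h).eval (-1)).natAbs)
  have hxB : ∀ m : ℕ, ∀ x y : ℤ, 3 ≤ m → y ≠ 0 → y ^ m = g.eval x → x.natAbs ≤ B := by
    intro m x y hm hy he
    obtain ⟨c1, d1, u, hc1, hd1, hu, hc1', hd1', e1⟩ := almost_power_eval g ((X + 1) * h) 0 (by rw [hgh]; simp; ring) f0 m x y hy he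
    obtain ⟨c2, d2, v, hc2, hd2, hv, hc2', hd2', e2⟩ := almost_power_eval g (X * h) (-1) (by rw [hgh]; simp; ring) f1 m x y hy he
    refine hB c1 (by omega) d1 (by omega) c2 (by omega) d2 (by omega) x.natAbs
      ⟨hc1, hd1, hc2, hd2, m, u, v, (x - -1).natAbs, hm, hu, hv, ?_, by rw [← e1, sub_zero], e2⟩
    have hne : y ^ m ≠ 0 := pow_ne_zero _ hy
    rw [he, hev] at hne
    have hx0 : x ≠ 0 := by rintro rfl; simp at hne
    have hx1 : x ≠ -1 := by rintro rfl; simp at hne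
    omega
  set G : ℕ := ∑ x ∈ Finset.Icc (-(B:ℤ)) B, (g.eval x).natAbs with hG
  have hGb : ∀ x : ℤ, x.natAbs ≤ B → (g.eval x).natAbs ≤ G := by
    intro x hx
    exact single_le_sum (f := fun x => (g.eval x).natAbs) (fun _ _ => Nat.zero_le _) (Finset.mem_Icc.mpr (by omega))
  clear_value G
  refine Set.Finite.subset ((Set.finite_Iic G).prod ((Set.finite_Icc (-(B:ℤ)) B).prod (Set.finite_Icc (-(G:ℤ)) G))) ?_
  rintro ⟨m, x, y⟩ ⟨hm, hy, he⟩
  simp only at hm hy he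
  have hx := hxB m x y hm hy he
  have hGx := hGb x hx
  have hy2 : 2 ≤ y.natAbs := by
    have heven : Even (y ^ m) := by
      rw [he, hev]; exact (Int.even_mul_succ_self x).mul_right _
    have hye : Even y := (Int.even_pow.mp heven).1
    obtain ⟨s, hs⟩ := hye
    omega
  rw [← he, Int.natAbs_pow] at hGx
  have hm1 : m < y.natAbs ^ m := Nat.lt_pow_self (by omega)
  have hy1 : y.natAbs ≤ y.natAbs ^ m := Nat.le_self_pow (by omega) _
  simp only [Set.mem_prod, Set.mem_Iic, Set.mem_Icc]
  refine ⟨by omega, ⟨by omega, by omega⟩, by omega, by omega⟩
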